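/- Let R = S ×_k T be a non-trivial fiber product and let M, N be nonzero finitely generated R-modules such that Tor_i^R(M, N) = 0 for all sufficiently large i. Set q := max{i ≥ 0 : Tor_i^R(M, N) ≠ 0}. Assume at least one of the following conditions holds: (1) q = 0; (2) depth_R(Tor_q^R(M, N)) ≤ 1; (3) depth(S) = 0 or depth(T) = 0; (4) one of the modules M, N is a first syzygy of a finitely generated R-module; (5) one of the modules M, N is isomorphic as an R-module to S or to T; (6) depth_R(N) = 0 and N has infinite projective dimension over R. Then q ≤ 1 and depth_R(M) + depth_R(N) = depth(R) + depth_R(Tor_q^R(M, N)) − q. -/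

import Mathlib

open CategoryTheory Opposite IsLocalRing

noncomputable section

set_option maxHeartbeats 1000000
set_option synthInstance.maxHeartbeats 1000000

/-- Vanishing of `Tor_i^A(M, N)`. -/
abbrev TorZero (A : Type) [CommRing A] (M N : Type) [AddCommGroup M] [Module A M]
    [AddCommGroup N] [Module A N] (i : ℕ) : Prop :=
  Subsingleton (((Tor (ModuleCat A) i).obj (ModuleCat.of A M)).obj (ModuleCat.of A N))

/-- Vanishing of `Ext^i_A(M, N)`. -/
abbrev ExtZero (A : Type) [CommRing A] (M N : Type) [AddCommGroup M] [Module A M]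
    [AddCommGroup N] [Module A N] (i : ℕ) : Prop :=
  Subsingleton (((Ext A (ModuleCat A) i).obj (op (ModuleCat.of A M))).obj (ModuleCat.of A N))

/-- `M` has projective dimension at most `n` over `A`:
`Ext^i_A(M, -) = 0` for all `i > n`. -/
def PdLE (A : Type) [CommRing A] (M : Type) [AddCommGroup M] [Module A M] (n : ℕ) : Prop :=
  ∀ (N : ModuleCat A) (i : ℕ), n < i →
    Subsingleton (((Ext A (ModuleCat A) i).obj (op (ModuleCat.of A M))).obj N)

/-- `N` has injective dimension at most `n` over `A`:
`Ext^i_A(-, N) = 0` for all `i > n`. -/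
def IdLE (A : Type) [CommRing A] (N : Type) [AddCommGroup N] [Module A N] (n : ℕ) : Prop :=
  ∀ (X : ModuleCat A) (i : ℕ), n < i →
    Subsingleton (((Ext A (ModuleCat A) i).obj (op X)).obj (ModuleCat.of A N))

/-- The depth of a module over a noetherian local ring, as an extended natural number:
`inf { i | Ext^i_A(k, M) ≠ 0 }`. -/
def depthM (A : Type) [CommRing A] [IsLocalRing A] (M : Type) [AddCommGroup M]
    [Module A M] : ℕ∞ :=
  sInf {n : ℕ∞ | ∃ i : ℕ, n = i ∧
    ¬ Subsingleton (((Ext A (ModuleCat A) i).obj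
        (op (ModuleCat.of A (A ⧸ maximalIdeal A)))).obj (ModuleCat.of A M))}

/-- The fiber product `S ×ₖ T` as a subring of `S × T`. -/
def fiberProd {S T k : Type} [CommRing S] [CommRing T] [CommRing k]
    (πS : S →+* k) (πT : T →+* k) : Subring (S × T) :=
  RingHom.eqLocus (πS.comp (RingHom.fst S T)) (πT.comp (RingHom.snd S T))

/-- The projection from the fiber product to `S`. -/
def ρS {S T k : Type} [CommRing S] [CommRing T] [CommRing k]
    (πS : S →+* k) (πT : T →+* k) : ↥(fiberProd πS πT) →+* S :=
  (RingHom.fst S T).comp (fiberProd πS πT).subtype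

/-- The projection from the fiber product to `T`. -/
def ρT {S T k : Type} [CommRing S] [CommRing T] [CommRing k]
    (πS : S →+* k) (πT : T →+* k) : ↥(fiberProd πS πT) →+* T :=
  (RingHom.snd S T).comp (fiberProd πS πT).subtype

/-- The `i`-th Betti number of a module `M` over a noetherian local ring `A`:
the `k`-dimension of `Tor_i^A(M, k) ⊗_A k`; since `Tor_i^A(M, k)` is annihilated
by the maximal ideal, this is `dim_k Tor_i^A(M, k)`. -/
noncomputable def betti (A : Type) [CommRing A] [IsLocalRing A] (M : Type) [AddCommGroup M]
    [Module A M] (i : ℕ) : ℕ :=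
  let X : ModuleCat A :=
    ((Tor (ModuleCat A) i).obj (ModuleCat.of A M)).obj (ModuleCat.of A (A ⧸ maximalIdeal A))
  Module.finrank (A ⧸ maximalIdeal A) (X ⧸ (maximalIdeal A • (⊤ : Submodule A X)))

/-- `M` is a first syzygy over `A` of a finitely generated `A`-module, i.e. `M` embeds
into a finite free `A`-module (as the kernel of `F ↠ L` for the quotient `L`). -/
def IsFirstSyzygy (A : Type) [CommRing A] (M : Type) [AddCommGroup M] [Module A M] : Prop :=
  ∃ (n : ℕ) (f : M →ₗ[A] (Fin n → A)), Function.Injective f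

section DepthFormula

open MonoidalCategory Limits TensorProduct

variable {A : Type} [CommRing A]

/-- The complex `M ⊗ P` of which `Tor` is the homology. -/
abbrev tensorComplex (M : ModuleCat.{0} A) {N : ModuleCat.{0} A} (P : ProjectiveResolution N) :
    ChainComplex (ModuleCat.{0} A) ℕ :=
  (((tensoringLeft (ModuleCat A)).obj M).mapHomologicalComplex _).obj P.complex

abbrev tensorComplexMap {M M' : ModuleCat.{0} A} (f : M ⟶ M') {N : ModuleCat.{0} A}
    (P : ProjectiveResolution N) : tensorComplex M P ⟶ tensorComplex M' P :=
  (NatTrans.mapHomologicalComplex ((tensoringLeft (ModuleCat A)).map f) _).app P.complex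

/-- The short exact sequence of complexes obtained by tensoring with a projective resolution. -/
def tensorShortComplex (S : ShortComplex (ModuleCat.{0} A)) {N : ModuleCat.{0} A}
    (P : ProjectiveResolution N) : ShortComplex (ChainComplex (ModuleCat.{0} A) ℕ) where
  X₁ := tensorComplex S.X₁ P
  X₂ := tensorComplex S.X₂ P
  X₃ := tensorComplex S.X₃ P
  f := tensorComplexMap S.f P
  g := tensorComplexMap S.g P
  zero := by
    ext i : 1
    change (S.f ▷ P.complex.X i) ≫ (S.g ▷ P.complex.X i) = 0
    rw [← comp_whiskerRight, S.zero, MonoidalPreadditive.zero_whiskerRight]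

instance flat_of_projective (P : ModuleCat.{0} A) [Projective P] : Module.Flat A P :=
  have : Module.Projective A P := (IsProjective.iff_projective (R := A) (P := P)).mpr ‹_›
  inferInstance

theorem tensorShortComplex_shortExact (S : ShortComplex (ModuleCat.{0} A)) (hS : S.ShortExact)
    {N : ModuleCat.{0} A} (P : ProjectiveResolution N) :
    (tensorShortComplex S P).ShortExact := by
  refine HomologicalComplex.shortExact_of_degreewise_shortExact _ fun i => ?_
  exact hS.map_of_exact (tensorRight (P.complex.X i))

theorem isZero_homology_tensorComplex (M : ModuleCat.{0} A) [Module.Flat A M]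
    {N : ModuleCat.{0} A} (P : ProjectiveResolution N) (i : ℕ) :
    IsZero ((tensorComplex M P).homology (i + 1)) := by
  rw [← HomologicalComplex.exactAt_iff_isZero_homology]
  have h := P.complex_exactAt_succ i
  rw [HomologicalComplex.exactAt_iff] at h ⊢
  exact Module.Flat.lTensor_shortComplex_exact (M := M) _ h

/-- The canonical isomorphism `H₀(M ⊗ P) ≅ M ⊗ N`. -/
def homologyZeroIso (M : ModuleCat.{0} A) {N : ModuleCat.{0} A} (P : ProjectiveResolution N) :
    (tensorComplex M P).homology 0 ≅ M ⊗ N :=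
  ChainComplex.isoHomologyι₀ _ ≪≫
    @asIso _ _ _ _ (P.fromLeftDerivedZero' ((tensoringLeft (ModuleCat A)).obj M))
      (by
        have : PreservesFiniteColimits ((tensoringLeft (ModuleCat A)).obj M) :=
          inferInstanceAs (PreservesFiniteColimits (tensorLeft M))
        infer_instance)

theorem homologyZeroIso_naturality {M M' : ModuleCat.{0} A} (f : M ⟶ M') {N : ModuleCat.{0} A}
    (P : ProjectiveResolution N) :
    HomologicalComplex.homologyMap (tensorComplexMap f P) 0 ≫ (homologyZeroIso M' P).hom =
      (homologyZeroIso M P).hom ≫ (f ▷ N) := by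
  have key : HomologicalComplex.opcyclesMap (tensorComplexMap f P) 0 ≫
      P.fromLeftDerivedZero' ((tensoringLeft (ModuleCat A)).obj M') =
      P.fromLeftDerivedZero' ((tensoringLeft (ModuleCat A)).obj M) ≫ (f ▷ N) := by
    rw [← cancel_epi (HomologicalComplex.pOpcycles _ _),
      HomologicalComplex.p_opcyclesMap_assoc,
      ProjectiveResolution.pOpcycles_comp_fromLeftDerivedZero',
      ProjectiveResolution.pOpcycles_comp_fromLeftDerivedZero'_assoc]
    exact (whisker_exchange f (P.π.f 0)).symm
  simp only [homologyZeroIso, Iso.trans_hom, asIso_hom, Category.assoc, ← key]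
  exact HomologicalComplex.homologyι_naturality_assoc _ _ _

/-- `Tor` of unbundled modules. -/
abbrev TorMod (A : Type) [CommRing A] (M N : Type) [AddCommGroup M] [Module A M]
    [AddCommGroup N] [Module A N] (i : ℕ) : ModuleCat.{0} A :=
  ((Tor (ModuleCat A) i).obj (ModuleCat.of A M)).obj (ModuleCat.of A N)

variable {K F M N X Y : Type} [AddCommGroup K] [Module A K] [AddCommGroup F] [Module A F]
  [AddCommGroup M] [Module A M] [AddCommGroup N] [Module A N] [AddCommGroup X] [Module A X]
  [AddCommGroup Y] [Module A Y]

/-- `Tor` as homology of a tensored resolution. -/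
def torIso (M N : ModuleCat.{0} A) (i : ℕ) :
    ((Tor (ModuleCat A) i).obj M).obj N ≅
      (tensorComplex M (projectiveResolution N)).homology i :=
  (projectiveResolution N).isoLeftDerivedObj _ i

theorem TorMod.zero_equiv : Nonempty (TorMod A M N 0 ≃ₗ[A] M ⊗[A] N) :=
  ⟨(torIso _ _ 0 ≪≫ homologyZeroIso _ _).toLinearEquiv⟩

theorem TorZero.of_flat [Module.Flat A F] (i : ℕ) : TorZero A F N (i + 1) := by
  have : Module.Flat A (ModuleCat.of A F) := ‹_›
  exact ModuleCat.subsingleton_of_isZero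
    ((isZero_homology_tensorComplex (ModuleCat.of A F) (projectiveResolution
      (ModuleCat.of A N)) i).of_iso (torIso _ _ _))

theorem shortExact_of_linear (f : K →ₗ[A] F) (g : F →ₗ[A] M) (hf : Function.Injective f)
    (hg : Function.Surjective g) (hfg : Function.Exact f g) :
    ∃ S : ShortComplex (ModuleCat.{0} A), S.ShortExact ∧
      S = ShortComplex.mk (ModuleCat.ofHom f) (ModuleCat.ofHom g)
        (ModuleCat.hom_ext (DFunLike.ext _ _ hfg.apply_apply_eq_zero)) := by
  refine ⟨_, ?_, rfl⟩
  have : Mono (ModuleCat.ofHom f) := (ModuleCat.mono_iff_injective _).mpr hf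
  have : Epi (ModuleCat.ofHom g) := (ModuleCat.epi_iff_surjective _).mpr hg
  exact ⟨(ShortComplex.ShortExact.moduleCat_exact_iff_function_exact _).mpr hfg⟩

theorem TorMod.shift (f : K →ₗ[A] F) (g : F →ₗ[A] M) (hf : Function.Injective f)
    (hg : Function.Surjective g) (hfg : Function.Exact f g) [Module.Flat A F] (i : ℕ) :
    Nonempty (TorMod A M N (i + 2) ≃ₗ[A] TorMod A K N (i + 1)) := by
  obtain ⟨S, hS, rfl⟩ := shortExact_of_linear f g hf hg hfg
  have : Module.Flat A (ModuleCat.of A F) := ‹_›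
  have hS' := tensorShortComplex_shortExact _ hS (projectiveResolution (ModuleCat.of A N))
  have h1 := isZero_homology_tensorComplex (ModuleCat.of A F)
    (projectiveResolution (ModuleCat.of A N))
  exact ⟨(torIso (ModuleCat.of A M) (ModuleCat.of A N) (i + 2) ≪≫
    hS'.δIso (i + 2) (i + 1) (by simp) (h1 (i + 1)) (h1 i) ≪≫
    (torIso (ModuleCat.of A K) (ModuleCat.of A N) (i + 1)).symm).toLinearEquiv⟩

theorem TorZero.middle (f : K →ₗ[A] F) (g : F →ₗ[A] M) (hf : Function.Injective f)
    (hg : Function.Surjective g) (hfg : Function.Exact f g) {i : ℕ} (h₁ : TorZero A K N i)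
    (h₂ : TorZero A M N i) : TorZero A F N i := by
  obtain ⟨S, hS, rfl⟩ := shortExact_of_linear f g hf hg hfg
  have hS' := tensorShortComplex_shortExact _ hS (projectiveResolution (ModuleCat.of A N))
  have h₁' : IsZero ((tensorComplex (ModuleCat.of A K)
      (projectiveResolution (ModuleCat.of A N))).homology i) :=
    (ModuleCat.isZero_of_subsingleton (TorMod A K N i)).of_iso (torIso _ _ i).symm
  have h₂' : IsZero ((tensorComplex (ModuleCat.of A M)
      (projectiveResolution (ModuleCat.of A N))).homology i) :=
    (ModuleCat.isZero_of_subsingleton (TorMod A M N i)).of_iso (torIso _ _ i).symm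
  have h := (hS'.homology_exact₂ i).isZero_of_both_zeros (h₁'.eq_of_src _ _)
    (h₂'.eq_of_tgt _ _)
  exact ModuleCat.subsingleton_of_isZero (h.of_iso (torIso _ _ i))

theorem TorMod.one_equiv (f : K →ₗ[A] F) (g : F →ₗ[A] M) (hf : Function.Injective f)
    (hg : Function.Surjective g) (hfg : Function.Exact f g) [Module.Flat A F] :
    Nonempty (TorMod A M N 1 ≃ₗ[A] LinearMap.ker (f.rTensor N)) := by
  obtain ⟨S, hS, rfl⟩ := shortExact_of_linear f g hf hg hfg
  have : Module.Flat A (ModuleCat.of A F) := ‹_›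
  let P := projectiveResolution (ModuleCat.of A N)
  have hS' := tensorShortComplex_shortExact _ hS P
  have h1 := isZero_homology_tensorComplex (ModuleCat.of A F) P 0
  have hmono : Mono (hS'.δ 1 0 (by simp)) := hS'.mono_δ _ _ _ h1
  have hex := (ShortComplex.ShortExact.moduleCat_exact_iff_function_exact _).mp
    (hS'.homology_exact₁ 1 0 (by simp))
  let eK := (homologyZeroIso (ModuleCat.of A K) P).toLinearEquiv
  let eF := (homologyZeroIso (ModuleCat.of A F) P).toLinearEquiv
  let d : (tensorComplex (ModuleCat.of A M) P).homology 1 →ₗ[A] K ⊗[A] N :=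
    eK.toLinearMap ∘ₗ (hS'.δ 1 0 (by simp)).hom
  have hd : Function.Injective d :=
    eK.injective.comp ((ModuleCat.mono_iff_injective _).mp hmono)
  have hnat : ∀ x, f.rTensor N (eK x) =
      eF ((HomologicalComplex.homologyMap (tensorComplexMap (ModuleCat.ofHom f) P) 0).hom x) :=
    fun x => (LinearMap.congr_fun (congrArg ModuleCat.Hom.hom
      (homologyZeroIso_naturality (ModuleCat.ofHom f) P)) x).symm
  have hr : LinearMap.range d = LinearMap.ker (f.rTensor N) := by
    ext y
    obtain ⟨x, rfl⟩ := eK.surjective y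
    rw [LinearMap.mem_ker, hnat, LinearEquiv.map_eq_zero_iff]
    refine Iff.trans ?_ (hex x).symm
    constructor
    · rintro ⟨z, hz⟩
      exact ⟨z, eK.injective hz⟩
    · rintro ⟨z, hz⟩
      exact ⟨z, congrArg eK hz⟩
  exact ⟨(torIso (ModuleCat.of A M) (ModuleCat.of A N) 1).toLinearEquiv ≪≫ₗ
    LinearEquiv.ofInjective d hd ≪≫ₗ LinearEquiv.ofEq _ _ hr⟩

theorem TorZero.of_retract (f : X →ₗ[A] M) (g : M →ₗ[A] X) (hgf : g ∘ₗ f = LinearMap.id) {i : ℕ}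
    (h : TorZero A M N i) : TorZero A X N i := by
  let r : Retract (ModuleCat.of A X) (ModuleCat.of A M) :=
    ⟨ModuleCat.ofHom f, ModuleCat.ofHom g, ModuleCat.hom_ext hgf⟩
  let r' := r.map ((Tor (ModuleCat A) i).flip.obj (ModuleCat.of A N))
  have hz := ModuleCat.isZero_of_subsingleton (TorMod A M N i)
  refine ModuleCat.subsingleton_of_isZero (hz.of_mono r'.i)

theorem TorZero.prod {i : ℕ} (h₁ : TorZero A X N i) (h₂ : TorZero A Y N i) :
    TorZero A (X × Y) N i :=
  h₁.middle (LinearMap.inl A X Y) (LinearMap.snd A X Y) LinearMap.inl_injective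
    LinearMap.snd_surjective Function.Exact.inl_snd h₂

/-- Both kernels computing `Tor₁` agree. -/
theorem ker_rTensor_equiv_ker_lTensor {K' F' : Type} [AddCommGroup K'] [Module A K']
    [AddCommGroup F'] [Module A F'] (f : K →ₗ[A] F) (g : F →ₗ[A] M) (hf : Function.Injective f)
    (hg : Function.Surjective g) (hfg : Function.Exact f g) [Module.Flat A F]
    (f' : K' →ₗ[A] F') (g' : F' →ₗ[A] N) (hf' : Function.Injective f')
    (hg' : Function.Surjective g') (hfg' : Function.Exact f' g') [Module.Flat A F'] :
    Nonempty (LinearMap.ker (f.rTensor N) ≃ₗ[A] LinearMap.ker (f'.lTensor M)) := by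
  let W : Submodule A ((K ⊗[A] F') × (F ⊗[A] K')) :=
    LinearMap.ker ((f.rTensor F' ∘ₗ LinearMap.fst A _ _) - (f'.lTensor F ∘ₗ LinearMap.snd A _ _))
  have hW : ∀ w : W, f.rTensor F' w.1.1 = f'.lTensor F w.1.2 := fun w => sub_eq_zero.mp w.2
  let φ : W →ₗ[A] K ⊗[A] N := g'.lTensor K ∘ₗ LinearMap.fst A _ _ ∘ₗ W.subtype
  let ψ : W →ₗ[A] M ⊗[A] K' := g.rTensor K' ∘ₗ LinearMap.snd A _ _ ∘ₗ W.subtype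
  have comm {U V U' V' : Type} [AddCommGroup U] [Module A U] [AddCommGroup V] [Module A V]
      [AddCommGroup U'] [Module A U'] [AddCommGroup V'] [Module A V'] (a : U →ₗ[A] V)
      (b : U' →ₗ[A] V') (z : U ⊗[A] U') :
      b.lTensor V (a.rTensor U' z) = a.rTensor V' (b.lTensor U z) := by
    rw [← LinearMap.comp_apply, ← LinearMap.comp_apply, LinearMap.lTensor_comp_rTensor,
      LinearMap.rTensor_comp_lTensor]
  have hφ : LinearMap.range φ = LinearMap.ker (f.rTensor N) := by
    ext w
    constructor
    · rintro ⟨w, rfl⟩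
      change f.rTensor N (g'.lTensor K w.1.1) = 0
      rw [← comm, hW]
      exact (lTensor_exact F hfg' hg').apply_apply_eq_zero _
    · intro hw
      obtain ⟨x, rfl⟩ := LinearMap.lTensor_surjective K hg' w
      rw [LinearMap.mem_ker, ← comm] at hw
      obtain ⟨y, hy⟩ := (lTensor_exact F hfg' hg' _).mp hw
      exact ⟨⟨(x, y), sub_eq_zero.mpr hy.symm⟩, rfl⟩
  have hψ : LinearMap.range ψ = LinearMap.ker (f'.lTensor M) := by
    ext w
    constructor
    · rintro ⟨w, rfl⟩
      change f'.lTensor M (g.rTensor K' w.1.2) = 0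
      rw [comm, ← hW]
      exact (rTensor_exact F' hfg hg).apply_apply_eq_zero _
    · intro hw
      obtain ⟨x, rfl⟩ := LinearMap.rTensor_surjective K' hg w
      rw [LinearMap.mem_ker, comm] at hw
      obtain ⟨y, hy⟩ := (rTensor_exact F' hfg hg _).mp hw
      exact ⟨⟨(y, x), sub_eq_zero.mpr hy⟩, rfl⟩
  have hker : LinearMap.ker φ = LinearMap.ker ψ := by
    ext w
    constructor
    · intro h
      obtain ⟨z, hz⟩ := (lTensor_exact K hfg' hg' w.1.1).mp h
      have h2 : f.rTensor K' z = w.1.2 := by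
        apply Module.Flat.lTensor_preserves_injective_linearMap (M := F) f' hf'
        rw [comm, hz, hW]
      change g.rTensor K' w.1.2 = 0
      rw [← h2]
      exact (rTensor_exact K' hfg hg).apply_apply_eq_zero _
    · intro h
      obtain ⟨z, hz⟩ := (rTensor_exact K' hfg hg w.1.2).mp h
      have h2 : f'.lTensor K z = w.1.1 := by
        apply Module.Flat.rTensor_preserves_injective_linearMap (M := F') f hf
        rw [← comm, hz, hW]
      change g'.lTensor K w.1.1 = 0
      rw [← h2]
      exact (lTensor_exact K hfg' hg').apply_apply_eq_zero _
  exact ⟨(LinearEquiv.ofEq _ _ hφ).symm ≪≫ₗ φ.quotKerEquivRange.symm ≪≫ₗ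
    Submodule.quotEquivOfEq _ _ hker ≪≫ₗ ψ.quotKerEquivRange ≪≫ₗ LinearEquiv.ofEq _ _ hψ⟩

/-- `ker (f ⊗ N)` and `ker (N ⊗ f)` agree. -/
def kerRTensorEquivKerLTensor (f : K →ₗ[A] F) (N : Type) [AddCommGroup N] [Module A N] :
    LinearMap.ker (f.rTensor N) ≃ₗ[A] LinearMap.ker (f.lTensor N) :=
  (TensorProduct.comm A K N).ofSubmodules _ _ (by
    rw [Submodule.map_equiv_eq_comap_symm]
    ext x
    have h : f.rTensor N ((TensorProduct.comm A K N).symm x) =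
        TensorProduct.comm A N F (f.lTensor N x) :=
      LinearMap.congr_fun (g := (TensorProduct.comm A N F).toLinearMap ∘ₗ f.lTensor N)
        (f := f.rTensor N ∘ₗ (TensorProduct.comm A K N).symm.toLinearMap)
        (TensorProduct.ext' fun _ _ => rfl) x
    change f.rTensor N ((TensorProduct.comm A K N).symm x) = 0 ↔ f.lTensor N x = 0
    rw [h, LinearEquiv.map_eq_zero_iff])

theorem ker_rTensor_eq_ker_lTensor (f : K →ₗ[A] F) (f' : Y →ₗ[A] X)
    (hf : Function.Injective f) (hf' : Function.Injective f') [Module.Flat A F]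
    [Module.Flat A X] : LinearMap.ker (f.rTensor Y) = LinearMap.ker (f'.lTensor K) := by
  have h1 := Module.Flat.lTensor_preserves_injective_linearMap (M := F) f' hf'
  have h2 := Module.Flat.rTensor_preserves_injective_linearMap (M := X) f hf
  ext x
  have h : f'.lTensor F (f.rTensor Y x) = f.rTensor X (f'.lTensor K x) := by
    rw [← LinearMap.comp_apply, ← LinearMap.comp_apply, LinearMap.lTensor_comp_rTensor,
      LinearMap.rTensor_comp_lTensor]
  rw [LinearMap.mem_ker, LinearMap.mem_ker, ← map_eq_zero_iff _ h1, h, map_eq_zero_iff _ h2]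

theorem exists_flat_presentation (A : Type) [CommRing A] (M : Type) [AddCommGroup M]
    [Module A M] :
    ∃ (K F : Type) (_ : AddCommGroup K) (_ : Module A K) (_ : AddCommGroup F) (_ : Module A F)
      (f : K →ₗ[A] F) (g : F →ₗ[A] M), Module.Flat A F ∧ Function.Injective f ∧
        Function.Surjective g ∧ Function.Exact f g :=
  ⟨LinearMap.ker (Finsupp.linearCombination A (id : M → M)), M →₀ A, inferInstance, inferInstance,
    inferInstance, inferInstance, (LinearMap.ker _).subtype, Finsupp.linearCombination A id,
    inferInstance, Subtype.val_injective, Finsupp.linearCombination_id_surjective A M,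
    LinearMap.exact_subtype_ker_map _⟩

/-- `Tor` is symmetric. -/
theorem TorMod.symm_equiv (M N : Type) [AddCommGroup M] [Module A M] [AddCommGroup N]
    [Module A N] (i : ℕ) : Nonempty (TorMod A M N i ≃ₗ[A] TorMod A N M i) := by
  induction i using Nat.strong_induction_on generalizing M N with
  | _ i ih =>
  obtain ⟨K, F, _, _, _, _, f, g, _, hf, hg, hfg⟩ := exists_flat_presentation A M
  obtain ⟨K', F', _, _, _, _, f', g', _, hf', hg', hfg'⟩ := exists_flat_presentation A N
  match i with
  | 0 =>
    obtain ⟨e⟩ := TorMod.zero_equiv (A := A) (M := M) (N := N)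
    obtain ⟨e'⟩ := TorMod.zero_equiv (A := A) (M := N) (N := M)
    exact ⟨e ≪≫ₗ TensorProduct.comm A M N ≪≫ₗ e'.symm⟩
  | 1 =>
    obtain ⟨e⟩ := TorMod.one_equiv (N := N) f g hf hg hfg
    obtain ⟨e'⟩ := TorMod.one_equiv (N := M) f' g' hf' hg' hfg'
    obtain ⟨e₁⟩ := ker_rTensor_equiv_ker_lTensor f g hf hg hfg f' g' hf' hg' hfg'
    exact ⟨e ≪≫ₗ e₁ ≪≫ₗ (kerRTensorEquivKerLTensor f' M).symm ≪≫ₗ e'.symm⟩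
  | 2 =>
    obtain ⟨e₁⟩ := TorMod.shift (N := N) f g hf hg hfg 0
    obtain ⟨e₂⟩ := ih 1 (by norm_num) K N
    obtain ⟨e₃⟩ := TorMod.one_equiv (N := K) f' g' hf' hg' hfg'
    obtain ⟨e₁'⟩ := TorMod.shift (N := M) f' g' hf' hg' hfg' 0
    obtain ⟨e₂'⟩ := ih 1 (by norm_num) K' M
    obtain ⟨e₃'⟩ := TorMod.one_equiv (N := K') f g hf hg hfg
    have hker := ker_rTensor_eq_ker_lTensor f f' hf hf'
    exact ⟨e₁ ≪≫ₗ e₂ ≪≫ₗ e₃ ≪≫ₗ kerRTensorEquivKerLTensor f' K ≪≫ₗ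
      LinearEquiv.ofEq _ _ hker.symm ≪≫ₗ e₃'.symm ≪≫ₗ e₂'.symm ≪≫ₗ e₁'.symm⟩
  | i + 3 =>
    obtain ⟨e₁⟩ := TorMod.shift (N := N) f g hf hg hfg (i + 1)
    obtain ⟨e₂⟩ := ih (i + 2) (by omega) K N
    obtain ⟨e₃⟩ := TorMod.shift (N := K) f' g' hf' hg' hfg' i
    obtain ⟨e₄⟩ := ih (i + 1) (by omega) K' K
    obtain ⟨e₁'⟩ := TorMod.shift (N := M) f' g' hf' hg' hfg' (i + 1)
    obtain ⟨e₂'⟩ := ih (i + 2) (by omega) K' M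
    obtain ⟨e₃'⟩ := TorMod.shift (N := K') f g hf hg hfg i
    exact ⟨e₁ ≪≫ₗ e₂ ≪≫ₗ e₃ ≪≫ₗ e₄ ≪≫ₗ e₃'.symm ≪≫ₗ e₂'.symm ≪≫ₗ e₁'.symm⟩

theorem TorZero.symm {i : ℕ} (h : TorZero A M N i) : TorZero A N M i :=
  (TorMod.symm_equiv N M i).some.toEquiv.subsingleton

/-- Vanishing of derived-functor `Ext` is vanishing of `Ext` in the derived category. -/
theorem subsingleton_ext_iff (X Y : ModuleCat.{0} A) (i : ℕ) :
    Subsingleton (((Ext A (ModuleCat A) i).obj (op X)).obj Y) ↔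
      Subsingleton (Abelian.Ext X Y i) := by
  let P := projectiveResolution X
  have e := (P.isoExt (R := A) i Y).toLinearEquiv.toEquiv
  rw [e.subsingleton_congr, ← ModuleCat.isZero_iff_subsingleton,
    ← HomologicalComplex.exactAt_iff_isZero_homology]
  match i with
  | 0 =>
    rw [HomologicalComplex.exactAt_iff' _ 0 0 1 (by simp) (by simp),
      ShortComplex.moduleCat_exact_iff, Abelian.Ext.addEquiv₀.toEquiv.subsingleton_congr]
    obtain ⟨p, hp, hdp, hdesc⟩ : ∃ p : P.complex.X 0 ⟶ X, Epi p ∧ P.complex.d 1 0 ≫ p = 0 ∧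
        ∀ φ : P.complex.X 0 ⟶ Y, P.complex.d 1 0 ≫ φ = 0 → ∃ φ' : X ⟶ Y, p ≫ φ' = φ :=
      ⟨P.π.f 0, epi_of_isColimit_cofork P.isColimitCokernelCofork, P.complex_d_comp_π_f_zero,
        fun φ hφ => ⟨P.isColimitCokernelCofork.desc (CokernelCofork.ofπ φ hφ),
          P.isColimitCokernelCofork.fac (CokernelCofork.ofπ φ hφ) WalkingParallelPair.one⟩⟩
    constructor
    · intro h
      refine subsingleton_of_forall_eq 0 fun φ => ?_
      have hdφ : P.complex.d 1 0 ≫ p ≫ φ = 0 := by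
        rw [← Category.assoc, hdp, zero_comp]
      obtain ⟨ψ, hψ⟩ := h (p ≫ φ) hdφ
      have hψ' : P.complex.d 0 0 ≫ (show P.complex.X 0 ⟶ Y from ψ) = p ≫ φ := hψ
      rw [P.complex.shape 0 0 (by simp), zero_comp] at hψ'
      exact zero_of_epi_comp p hψ'.symm
    · intro h φ hφ
      obtain ⟨φ', rfl⟩ := hdesc φ hφ
      rw [Subsingleton.elim φ' 0]
      exact ⟨0, (map_zero _).trans comp_zero.symm⟩
  | n + 1 =>
    rw [HomologicalComplex.exactAt_iff' _ n (n + 1) (n + 2) (by simp) (by simp),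
      ShortComplex.moduleCat_exact_iff]
    constructor
    · intro h
      refine subsingleton_of_forall_eq 0 fun α => ?_
      obtain ⟨f, hf, rfl⟩ := P.extMk_surjective α (n + 2) rfl
      rw [P.extMk_eq_zero_iff f (n + 2) rfl hf n rfl]
      exact h f hf
    · intro h φ hφ
      exact (P.extMk_eq_zero_iff φ (n + 2) rfl hφ n rfl).mp (Subsingleton.elim _ _)

/-- Vanishing of `Ext` in the derived category, for unbundled modules. -/
abbrev DExtZero (A : Type) [CommRing A] (X M : Type) [AddCommGroup X] [Module A X]
    [AddCommGroup M] [Module A M] (i : ℕ) : Prop :=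
  Subsingleton (Abelian.Ext (ModuleCat.of A X) (ModuleCat.of A M) i)

theorem extZero_iff {i : ℕ} : ExtZero A X M i ↔ DExtZero A X M i :=
  subsingleton_ext_iff _ _ _

/-- The linear maps inducing zero on `Ext^i(X, -)`. -/
def extKill (X M N : Type) [AddCommGroup X] [Module A X] [AddCommGroup M] [Module A M]
    [AddCommGroup N] [Module A N] (i : ℕ) : Submodule A (M →ₗ[A] N) where
  carrier := {f | ∀ x : Abelian.Ext (ModuleCat.of A X) (ModuleCat.of A M) i,
    x.comp (Abelian.Ext.mk₀ (ModuleCat.ofHom f)) (add_zero i) = 0}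
  add_mem' {f g} hf hg x := by
    rw [ModuleCat.ofHom_add, Abelian.Ext.mk₀_add, Abelian.Ext.comp_add, hf x, hg x, add_zero]
  zero_mem' x := by
    rw [ModuleCat.ofHom_zero, Abelian.Ext.mk₀_zero, Abelian.Ext.comp_zero]
  smul_mem' r f hf x := by
    have : ModuleCat.ofHom (r • f) = r • ModuleCat.ofHom f := rfl
    rw [this, Abelian.Ext.mk₀_smul, Abelian.Ext.comp_smul, hf x, smul_zero]

theorem mem_extKill_of_dExtZero {i : ℕ} (h : DExtZero A X M i) (f : M →ₗ[A] N) :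
    f ∈ extKill X M N i := fun x => by
  rw [h.elim x 0, Abelian.Ext.zero_comp]

theorem comp_mem_extKill_of_dExtZero {i : ℕ} (h : DExtZero A X N i) (f : M →ₗ[A] N)
    (g : N →ₗ[A] Y) : g ∘ₗ f ∈ extKill X M Y i := fun x => by
  have : ModuleCat.ofHom (g ∘ₗ f) = ModuleCat.ofHom f ≫ ModuleCat.ofHom g := rfl
  rw [this, ← Abelian.Ext.mk₀_comp_mk₀, ← Abelian.Ext.comp_assoc_of_third_deg_zero,
    h.elim (x.comp _ _) 0, Abelian.Ext.zero_comp]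

theorem mem_extKill_of_dExtZero_target {i : ℕ} (h : DExtZero A X N i) (f : M →ₗ[A] N) :
    f ∈ extKill X M N i := fun _ => h.elim _ _

theorem dExtZero_iff_id_mem {i : ℕ} :
    DExtZero A X M i ↔ LinearMap.id ∈ extKill (A := A) X M M i := by
  refine ⟨fun h => mem_extKill_of_dExtZero h _, fun h => subsingleton_of_forall_eq 0 fun x => ?_⟩
  have := h x
  rwa [ModuleCat.ofHom_id, Abelian.Ext.comp_mk₀_id] at this

theorem DExtZero.of_retract {i : ℕ} (h : DExtZero A X N i) (f : M →ₗ[A] N) (g : N →ₗ[A] M)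
    (hgf : g ∘ₗ f = LinearMap.id) : DExtZero A X M i :=
  dExtZero_iff_id_mem.mpr (hgf ▸ comp_mem_extKill_of_dExtZero h f g)

theorem DExtZero.congr (e : M ≃ₗ[A] N) {i : ℕ} : DExtZero A X M i ↔ DExtZero A X N i :=
  ⟨fun h => h.of_retract e.symm.toLinearMap e.toLinearMap (by simp),
    fun h => h.of_retract e.toLinearMap e.symm.toLinearMap (by simp)⟩

theorem DExtZero.pi {i : ℕ} (h : DExtZero A X M i) (n : ℕ) : DExtZero A X (Fin n → M) i := by
  rw [dExtZero_iff_id_mem]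
  have : (LinearMap.id : (Fin n → M) →ₗ[A] _) =
      ∑ j, LinearMap.single A (fun _ => M) j ∘ₗ LinearMap.proj j := by
    ext; simp [Finset.sum_apply, Pi.single_apply]
  rw [this]
  exact Submodule.sum_mem _ fun j _ => comp_mem_extKill_of_dExtZero h _ _

theorem DExtZero.pi_iff {i n : ℕ} (hn : n ≠ 0) :
    DExtZero A X (Fin n → M) i ↔ DExtZero A X M i := by
  refine ⟨fun h => ?_, fun h => h.pi n⟩
  have := Fin.pos_iff_nonempty.mp (Nat.pos_of_ne_zero hn)
  let j := Classical.arbitrary (Fin n)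
  exact h.of_retract (LinearMap.single A (fun _ => M) j) (LinearMap.proj j)
    (LinearMap.ext fun x => by simp)

theorem mem_extKill_of_mem_smul_top (I : Ideal A) (i : ℕ) {f : M →ₗ[A] N}
    (hf : f ∈ I • (⊤ : Submodule A (M →ₗ[A] N))) : f ∈ extKill (A ⧸ I) M N i := by
  refine Submodule.smul_le.mpr ?_ hf
  intro r hr g _ x
  have h0 : r • 𝟙 (ModuleCat.of A (A ⧸ I)) = 0 := by
    ext
    change r • (1 : A ⧸ I) = 0
    rw [Algebra.smul_def, mul_one]
    exact Ideal.Quotient.eq_zero_iff_mem.mpr hr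
  have h1 : r • x = 0 := by
    have : r • x = (Abelian.Ext.mk₀ (r • 𝟙 (ModuleCat.of A (A ⧸ I)))).comp x (zero_add i) := by
      simp [Abelian.Ext.mk₀_smul]
    rw [this, h0, Abelian.Ext.mk₀_zero, Abelian.Ext.zero_comp]
  have : ModuleCat.ofHom (r • g) = r • ModuleCat.ofHom g := rfl
  rw [this, Abelian.Ext.mk₀_smul, Abelian.Ext.comp_smul, ← Abelian.Ext.smul_comp, h1,
    Abelian.Ext.zero_comp]

section LongExact

variable (f : K →ₗ[A] F) (g : F →ₗ[A] M) (hf : Function.Injective f)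
  (hg : Function.Surjective g) (hfg : Function.Exact f g)

include hf hg hfg

theorem DExtZero.left {i : ℕ} (h₁ : DExtZero A X M i) (h₂ : f ∈ extKill X K F (i + 1)) :
    DExtZero A X K (i + 1) := by
  obtain ⟨S, hS, rfl⟩ := shortExact_of_linear f g hf hg hfg
  refine subsingleton_of_forall_eq 0 fun x => ?_
  obtain ⟨y, rfl⟩ := Abelian.Ext.covariant_sequence_exact₁ _ hS x (h₂ x) rfl
  rw [h₁.elim y 0, Abelian.Ext.zero_comp]

theorem DExtZero.right {i : ℕ} (h₁ : DExtZero A X F i) (h₂ : DExtZero A X K (i + 1)) :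
    DExtZero A X M i := by
  obtain ⟨S, hS, rfl⟩ := shortExact_of_linear f g hf hg hfg
  refine subsingleton_of_forall_eq 0 fun x => ?_
  obtain ⟨y, rfl⟩ := Abelian.Ext.covariant_sequence_exact₃ _ hS x rfl (h₂.elim _ _)
  rw [h₁.elim y 0, Abelian.Ext.zero_comp]

theorem DExtZero.of_mem_extKill {i : ℕ} (h₁ : DExtZero A X M i) (h₂ : f ∈ extKill X K F i) :
    DExtZero A X F i := by
  obtain ⟨S, hS, rfl⟩ := shortExact_of_linear f g hf hg hfg
  refine subsingleton_of_forall_eq 0 fun x => ?_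
  obtain ⟨y, rfl⟩ := Abelian.Ext.covariant_sequence_exact₂ _ hS x (h₁.elim _ _)
  exact h₂ y

theorem DExtZero.contravariant {i : ℕ} (h₁ : DExtZero A K X i) (h₂ : DExtZero A F X (i + 1)) :
    DExtZero A M X (i + 1) := by
  obtain ⟨S, hS, rfl⟩ := shortExact_of_linear f g hf hg hfg
  refine subsingleton_of_forall_eq 0 fun x => ?_
  obtain ⟨y, rfl⟩ := Abelian.Ext.contravariant_sequence_exact₃ hS _ x (h₂.elim _ _)
    (add_comm 1 i)
  rw [h₁.elim y 0, Abelian.Ext.comp_zero]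

end LongExact

theorem DExtZero.of_projective [Module.Projective A F] (i : ℕ) : DExtZero A F X (i + 1) := by
  have : Projective (ModuleCat.of A F) :=
    (IsProjective.iff_projective F).mp inferInstance
  exact Abelian.Ext.subsingleton_of_projective _ _ _

theorem PdLE.of_shortExact (f : K →ₗ[A] F) (g : F →ₗ[A] M) (hf : Function.Injective f)
    (hg : Function.Surjective g) (hfg : Function.Exact f g) [Module.Projective A K]
    [Module.Projective A F] : PdLE A M 1 := by
  intro N i hi
  obtain ⟨i, rfl⟩ : ∃ j, i = j + 2 := ⟨i - 2, by omega⟩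
  exact extZero_iff.mpr (DExtZero.contravariant (X := N) f g hf hg hfg
    (DExtZero.of_projective i) (DExtZero.of_projective (i + 1)))

theorem dExtZero_zero_iff (I : Ideal A) :
    DExtZero A (A ⧸ I) M 0 ↔ ∀ x : M, (∀ r ∈ I, r • x = 0) → x = 0 := by
  rw [DExtZero, Abelian.Ext.addEquiv₀.toEquiv.subsingleton_congr]
  constructor
  · intro h x hx
    let φ : A ⧸ I →ₗ[A] M := Submodule.liftQ I (LinearMap.toSpanSingleton A M x) fun r hr => hx r hr
    have h1 : ModuleCat.ofHom φ = 0 := h.elim _ _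
    have h2 : φ 1 = x := one_smul A x
    rw [← h2]
    exact LinearMap.congr_fun (congrArg ModuleCat.Hom.hom h1) 1
  · intro h
    refine subsingleton_of_forall_eq 0 fun φ => ?_
    ext
    change φ.hom (1 : A ⧸ I) = 0
    refine h _ fun r hr => ?_
    rw [← map_smul]
    have : r • (1 : A ⧸ I) = 0 := by
      rw [Algebra.smul_def, mul_one]
      exact Ideal.Quotient.eq_zero_iff_mem.mpr hr
    rw [this, map_zero]

theorem mem_smul_top_of_forall {n : ℕ} (I : Ideal A) (f : (Fin n → A) →ₗ[A] M)
    (h : ∀ x, f x ∈ I • (⊤ : Submodule A M)) :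
    f ∈ I • (⊤ : Submodule A ((Fin n → A) →ₗ[A] M)) := by
  have hf : f = ∑ j, LinearMap.toSpanSingleton A M (f (Pi.single j 1)) ∘ₗ LinearMap.proj j := by
    refine LinearMap.pi_ext' fun j => LinearMap.ext_ring ?_
    simp [Pi.single_apply]
  rw [hf]
  refine Submodule.sum_mem _ fun j _ => ?_
  let φ : M →ₗ[A] ((Fin n → A) →ₗ[A] M) :=
    (LinearMap.lcomp A M (LinearMap.proj j)) ∘ₗ
      (LinearMap.ringLmapEquivSelf A A M).symm.toLinearMap
  have h1 : φ (f (Pi.single j 1)) ∈ Submodule.map φ (I • ⊤) :=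
    Submodule.mem_map_of_mem (h _)
  rw [Submodule.map_smul''] at h1
  exact Submodule.smul_mono le_rfl le_top h1

theorem mem_smul_top_pi {n : ℕ} (I : Ideal A) {x : Fin n → A} (hx : ∀ j, x j ∈ I) :
    x ∈ I • (⊤ : Submodule A (Fin n → A)) := by
  rw [pi_eq_sum_univ' x]
  exact Submodule.sum_mem _ fun j _ => Submodule.smul_mem_smul (hx j) Submodule.mem_top

theorem rTensor_mem_smul_top (I : Ideal A) {f : K →ₗ[A] F}
    (hf : f ∈ I • (⊤ : Submodule A (K →ₗ[A] F))) (N : Type) [AddCommGroup N] [Module A N] :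
    f.rTensor N ∈ I • (⊤ : Submodule A (K ⊗[A] N →ₗ[A] F ⊗[A] N)) := by
  have h1 : LinearMap.rTensorHom N f ∈ Submodule.map (LinearMap.rTensorHom N) (I • ⊤) :=
    Submodule.mem_map_of_mem hf
  rw [Submodule.map_smul''] at h1
  exact Submodule.smul_mono le_rfl le_top h1

theorem apply_eq_zero_of_mem_smul_top (I : Ideal A) {f : K →ₗ[A] F}
    (hf : f ∈ I • (⊤ : Submodule A (K →ₗ[A] F))) {x : K} (hx : ∀ r ∈ I, r • x = 0) :
    f x = 0 := by
  have : I • (⊤ : Submodule A (K →ₗ[A] F)) ≤ LinearMap.ker (LinearMap.applyₗ (R := A) x) := by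
    refine Submodule.smul_le.mpr fun r hr g _ => ?_
    change r • g x = 0
    rw [← map_smul, hx r hr, map_zero]
  exact this hf

theorem DExtZero.zero_of_injective {I : Ideal A} (h : DExtZero A (A ⧸ I) F 0) (f : K →ₗ[A] F)
    (hf : Function.Injective f) : DExtZero A (A ⧸ I) K 0 := by
  rw [dExtZero_zero_iff] at h ⊢
  intro x hx
  refine hf ?_
  rw [map_zero]
  exact h _ fun r hr => by rw [← map_smul, hx r hr, map_zero]

theorem dExtZero_pi_tensor_iff {n i : ℕ} (hn : n ≠ 0) :
    DExtZero A X ((Fin n → A) ⊗[A] N) i ↔ DExtZero A X N i :=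
  (DExtZero.congr (TensorProduct.comm A _ N ≪≫ₗ TensorProduct.piScalarRight A A N (Fin n))).trans
    (DExtZero.pi_iff hn)

section Depth

variable [IsLocalRing A]

theorem natCast_le_depthM_iff (n : ℕ) :
    (n : ℕ∞) ≤ depthM A M ↔ ∀ i < n, DExtZero A (A ⧸ maximalIdeal A) M i := by
  rw [depthM, le_sInf_iff]
  constructor
  · intro h i hi
    by_contra hc
    have := h i ⟨i, rfl, fun h' => hc (extZero_iff.mp h')⟩
    exact absurd (Nat.cast_le.mp this) (by omega)
  · rintro h _ ⟨i, rfl, hi⟩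
    by_contra hc
    exact hi (extZero_iff.mpr (h i (by exact_mod_cast not_le.mp hc)))

theorem depthM_congr (h : ∀ i, DExtZero A (A ⧸ maximalIdeal A) M i ↔
    DExtZero A (A ⧸ maximalIdeal A) N i) : depthM A M = depthM A N :=
  ENat.eq_of_forall_natCast_le_iff fun k => by simp [natCast_le_depthM_iff, h]

theorem depthM_congr_equiv (e : M ≃ₗ[A] N) : depthM A M = depthM A N :=
  depthM_congr fun _ => DExtZero.congr e

theorem depthM_eq_add_one (h0 : DExtZero A (A ⧸ maximalIdeal A) N 0)
    (h : ∀ i, DExtZero A (A ⧸ maximalIdeal A) M i ↔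
      DExtZero A (A ⧸ maximalIdeal A) N i ∧ DExtZero A (A ⧸ maximalIdeal A) N (i + 1)) :
    depthM A N = depthM A M + 1 := by
  refine ENat.eq_of_forall_natCast_le_iff fun k => ?_
  match k with
  | 0 => simp
  | k + 1 =>
    rw [Nat.cast_add, Nat.cast_one, ENat.add_le_add_iff_right (by simp), ← Nat.cast_one,
      ← Nat.cast_add, natCast_le_depthM_iff, natCast_le_depthM_iff]
    constructor
    · intro hN i hi
      exact (h i).mpr ⟨hN i (by omega), hN (i + 1) (by omega)⟩
    · intro hM i hi
      match i with
      | 0 => exact h0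
      | i + 1 => exact ((h i).mp (hM i (by omega))).2

theorem depthM_eq_zero_iff : depthM A M = 0 ↔ ¬ DExtZero A (A ⧸ maximalIdeal A) M 0 := by
  rw [← not_iff_not, not_not, ← ne_eq, ← Order.one_le_iff_ne_zero, ← Nat.cast_one,
    natCast_le_depthM_iff]
  simp

theorem depthM_le_one_iff : depthM A M ≤ 1 ↔ ¬ (DExtZero A (A ⧸ maximalIdeal A) M 0 ∧
    DExtZero A (A ⧸ maximalIdeal A) M 1) := by
  rw [← not_lt, not_iff_not, ← ENat.add_one_le_iff (by simp)]
  change ((1 : ℕ) : ℕ∞) + ((1 : ℕ) : ℕ∞) ≤ _ ↔ _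
  rw [← Nat.cast_add, natCast_le_depthM_iff]
  refine ⟨fun h => ⟨h 0 (by simp), h 1 (by simp)⟩, fun h i hi => ?_⟩
  interval_cases i
  exacts [h.1, h.2]

theorem depthM_eq_one_iff : depthM A M = 1 ↔ DExtZero A (A ⧸ maximalIdeal A) M 0 ∧
    ¬ DExtZero A (A ⧸ maximalIdeal A) M 1 := by
  have h := natCast_le_depthM_iff (A := A) (M := M) 1
  rw [Nat.cast_one] at h
  rw [le_antisymm_iff, depthM_le_one_iff, h]
  simp only [Nat.lt_one_iff, forall_eq]
  tauto

/-- A minimal finite free resolution of length one. -/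
structure HasMinimalLengthOneResolution (A M : Type) [CommRing A] [IsLocalRing A]
    [AddCommGroup M] [Module A M] (a b : ℕ) where
  f : (Fin a → A) →ₗ[A] (Fin b → A)
  g : (Fin b → A) →ₗ[A] M
  injective : Function.Injective f
  surjective : Function.Surjective g
  exact : Function.Exact f g
  minimal : ∀ x j, f x j ∈ maximalIdeal A

namespace HasMinimalLengthOneResolution

variable {a b : ℕ} (P : HasMinimalLengthOneResolution A M a b)

include P

theorem pdLE : PdLE A M 1 := PdLE.of_shortExact P.f P.g P.injective P.surjective P.exact

theorem torZero (i : ℕ) : TorZero A M N (i + 2) :=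
  have : TorZero A (Fin a → A) N (i + 1) := TorZero.of_flat i
  (TorMod.shift P.f P.g P.injective P.surjective P.exact i).some.toEquiv.subsingleton

theorem minimal_mem :
    P.f ∈ maximalIdeal A • (⊤ : Submodule A ((Fin a → A) →ₗ[A] (Fin b → A))) :=
  mem_smul_top_of_forall _ _ fun x => mem_smul_top_pi _ (P.minimal x)

theorem minimal_rTensor (N : Type) [AddCommGroup N] [Module A N] :
    P.f.rTensor N ∈ maximalIdeal A •
      (⊤ : Submodule A ((Fin a → A) ⊗[A] N →ₗ[A] (Fin b → A) ⊗[A] N)) :=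
  rTensor_mem_smul_top _ P.minimal_mem N

theorem rank_ne_zero (ha : a ≠ 0) : b ≠ 0 := by
  rintro rfl
  have : Nonempty (Fin a) := Fin.pos_iff_nonempty.mp (Nat.pos_of_ne_zero ha)
  have h := P.injective.subsingleton
  exact not_subsingleton _ h

theorem depthM_eq_zero (ha : a ≠ 0) (hA : ¬ DExtZero A (A ⧸ maximalIdeal A) A 1) :
    depthM A M = 0 := by
  rw [depthM_eq_zero_iff]
  intro h
  exact hA ((DExtZero.pi_iff ha).mp (h.left P.f P.g P.injective P.surjective P.exact
    (mem_extKill_of_mem_smul_top _ _ P.minimal_mem)))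

theorem dExtZero_ring_zero (ha : a ≠ 0) : DExtZero A (A ⧸ maximalIdeal A) A 0 := by
  rw [← DExtZero.pi_iff ha, dExtZero_zero_iff]
  intro x hx
  refine P.injective ?_
  rw [map_zero]
  exact apply_eq_zero_of_mem_smul_top _ P.minimal_mem hx

theorem not_dExtZero_tor_one (ha : a ≠ 0) (hN : ¬ DExtZero A (A ⧸ maximalIdeal A) N 0) :
    ¬ DExtZero A (A ⧸ maximalIdeal A) (TorMod A M N 1) 0 := by
  obtain ⟨e⟩ := TorMod.one_equiv (N := N) P.f P.g P.injective P.surjective P.exact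
  rw [DExtZero.congr (N := LinearMap.ker (P.f.rTensor N)) e, dExtZero_zero_iff]
  rw [← dExtZero_pi_tensor_iff ha, dExtZero_zero_iff] at hN
  contrapose! hN
  intro x hx
  have h := hN ⟨x, apply_eq_zero_of_mem_smul_top _ (P.minimal_rTensor N) hx⟩
    fun r hr => Subtype.ext (hx r hr)
  exact congrArg Subtype.val h

theorem depthM_eq_depthM_tor_zero_add_one (ha : a ≠ 0)
    (hN : DExtZero A (A ⧸ maximalIdeal A) N 0) (h : TorZero A M N 1) :
    depthM A N = depthM A (TorMod A M N 0) + 1 := by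
  obtain ⟨e⟩ := TorMod.one_equiv (N := N) P.f P.g P.injective P.surjective P.exact
  obtain ⟨e₀⟩ := TorMod.zero_equiv (A := A) (M := M) (N := N)
  have hinj : Function.Injective (P.f.rTensor N) := by
    rw [← LinearMap.ker_eq_bot, ← Submodule.subsingleton_iff_eq_bot]
    exact e.toEquiv.symm.subsingleton
  have hsurj := LinearMap.rTensor_surjective N P.surjective
  have hex := rTensor_exact N P.exact P.surjective
  have hk := fun i => mem_extKill_of_mem_smul_top _ i (P.minimal_rTensor N)
  have hb := P.rank_ne_zero ha
  refine depthM_eq_add_one hN fun i => ?_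
  rw [DExtZero.congr e₀]
  constructor
  · intro hM
    exact ⟨(dExtZero_pi_tensor_iff hb).mp (hM.of_mem_extKill _ _ hinj hsurj hex (hk i)),
      (dExtZero_pi_tensor_iff ha).mp (hM.left _ _ hinj hsurj hex (hk (i + 1)))⟩
  · rintro ⟨h₁, h₂⟩
    exact DExtZero.right _ _ hinj hsurj hex ((dExtZero_pi_tensor_iff hb).mpr h₁)
      ((dExtZero_pi_tensor_iff ha).mpr h₂)

theorem depthM_eq_one_of_depthM_tor_one_le (ha : a ≠ 0)
    (hN : DExtZero A (A ⧸ maximalIdeal A) N 0) (h : depthM A (TorMod A M N 1) ≤ 1) :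
    depthM A N = 1 ∧ depthM A (TorMod A M N 1) = 1 := by
  obtain ⟨e⟩ := TorMod.one_equiv (N := N) P.f P.g P.injective P.surjective P.exact
  have hb := P.rank_ne_zero ha
  have hK : DExtZero A (A ⧸ maximalIdeal A) (LinearMap.ker (P.f.rTensor N)) 0 :=
    ((dExtZero_pi_tensor_iff ha).mpr hN).zero_of_injective _ (Submodule.subtype_injective _)
  have hC : DExtZero A (A ⧸ maximalIdeal A) (LinearMap.range (P.f.rTensor N)) 0 :=
    ((dExtZero_pi_tensor_iff hb).mpr hN).zero_of_injective _ (Submodule.subtype_injective _)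
  have hK₀ := (DExtZero.congr (N := LinearMap.ker (P.f.rTensor N)) e).mpr hK
  rw [depthM_le_one_iff] at h
  refine ⟨depthM_eq_one_iff.mpr ⟨hN, fun h₁ => h ⟨hK₀, ?_⟩⟩,
    depthM_eq_one_iff.mpr ⟨hK₀, fun h₁ => h ⟨hK₀, h₁⟩⟩⟩
  rw [DExtZero.congr (N := LinearMap.ker (P.f.rTensor N)) e]
  refine hC.left (LinearMap.ker (P.f.rTensor N)).subtype (P.f.rTensor N).rangeRestrict
    (Submodule.subtype_injective _) (LinearMap.surjective_rangeRestrict _) ?_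
    (mem_extKill_of_dExtZero_target ((dExtZero_pi_tensor_iff ha).mpr h₁) _)
  rw [LinearMap.exact_iff, LinearMap.ker_rangeRestrict, Submodule.range_subtype]

end HasMinimalLengthOneResolution

end Depth

theorem exists_minimal_cover (A M : Type) [CommRing A] [IsLocalRing A] [AddCommGroup M]
    [Module A M] [Module.Finite A M] :
    ∃ (n : ℕ) (g : (Fin n → A) →ₗ[A] M), Function.Surjective g ∧
      ∀ x, g x = 0 → ∀ j, x j ∈ maximalIdeal A := by
  let w := Module.finBasis (ResidueField A) (ResidueField A ⊗[A] M)
  obtain ⟨v, hv⟩ := (TensorProduct.mk_surjective A M (ResidueField A)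
    Ideal.Quotient.mk_surjective).comp_left w
  refine ⟨_, Fintype.linearCombination A v, ?_, fun x hx => ?_⟩
  · rw [← LinearMap.range_eq_top, Fintype.range_linearCombination]
    exact span_eq_top_of_tmul_eq_basis _ w (congr_fun hv)
  · have h1 : ∑ j, residue A (x j) • w j = 0 := by
      have := congrArg (TensorProduct.mk A (ResidueField A) M 1) hx
      rw [map_zero, Fintype.linearCombination_apply, map_sum] at this
      rw [← this]
      refine Finset.sum_congr rfl fun j _ => ?_
      rw [map_smul, ← congr_fun hv j]
      rfl
    intro j
    rw [← residue_eq_zero_iff]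
    exact Fintype.linearIndependent_iff.mp w.linearIndependent _ h1 j

theorem rTensor_quotient_eq_zero {n : ℕ} (I : Ideal A) (f : K →ₗ[A] (Fin n → A))
    (hf : ∀ x j, f x j ∈ I) : f.rTensor (A ⧸ I) = 0 := by
  refine TensorProduct.ext' fun x y => ?_
  rw [LinearMap.rTensor_tmul, LinearMap.zero_apply]
  refine Submodule.smul_induction_on (p := fun z => z ⊗ₜ[A] y = 0)
    (mem_smul_top_pi I (hf x)) ?_ ?_
  · intro r hr z _
    obtain ⟨s, rfl⟩ := Ideal.Quotient.mk_surjective y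
    rw [TensorProduct.smul_tmul]
    have : r • (Ideal.Quotient.mk I s) = 0 := by
      rw [Algebra.smul_def]
      exact Ideal.Quotient.eq_zero_iff_mem.mpr (I.mul_mem_right s hr)
    rw [this, TensorProduct.tmul_zero]
  · intro z z' h h'
    rw [TensorProduct.add_tmul, h, h', add_zero]

/-- Eventual vanishing of `Tor`. -/
def TorVan (A M N : Type) [CommRing A] [AddCommGroup M] [Module A M] [AddCommGroup N]
    [Module A N] : Prop :=
  ∃ n : ℕ, ∀ i ≥ n, TorZero A M N i

theorem TorVan.symm (h : TorVan A M N) : TorVan A N M :=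
  h.imp fun _ h i hi => (h i hi).symm

theorem TorVan.of_retract (f : X →ₗ[A] M) (g : M →ₗ[A] X) (hgf : g ∘ₗ f = LinearMap.id)
    (h : TorVan A M N) : TorVan A X N :=
  h.imp fun _ h i hi => TorZero.of_retract f g hgf (h i hi)

theorem TorVan.syzygy (f : K →ₗ[A] F) (g : F →ₗ[A] M) (hf : Function.Injective f)
    (hg : Function.Surjective g) (hfg : Function.Exact f g) [Module.Flat A F]
    (h : TorVan A M N) : TorVan A K N := by
  obtain ⟨n, h⟩ := h
  refine ⟨n + 1, fun i hi => ?_⟩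
  obtain ⟨i, rfl⟩ : ∃ j, i = j + 1 := ⟨i - 1, by omega⟩
  have := h (i + 2) (by omega)
  exact (TorMod.shift f g hf hg hfg i).some.symm.toEquiv.subsingleton

theorem TorVan.of_syzygy (f : K →ₗ[A] F) (g : F →ₗ[A] M) (hf : Function.Injective f)
    (hg : Function.Surjective g) (hfg : Function.Exact f g) [Module.Flat A F]
    (h : TorVan A K N) : TorVan A M N := by
  obtain ⟨n, h⟩ := h
  refine ⟨n + 2, fun i hi => ?_⟩
  obtain ⟨i, rfl⟩ : ∃ j, i = j + 2 := ⟨i - 2, by omega⟩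
  have := h (i + 1) (by omega)
  exact (TorMod.shift f g hf hg hfg i).some.toEquiv.subsingleton

theorem TorVan.prod (h : TorVan A X N) (h' : TorVan A Y N) : TorVan A (X × Y) N := by
  obtain ⟨n, h⟩ := h
  obtain ⟨n', h'⟩ := h'
  exact ⟨max n n', fun i hi => (h i (le_of_max_le_left hi)).prod (h' i (le_of_max_le_right hi))⟩

theorem TorVan.congr (e : M ≃ₗ[A] X) (h : TorVan A M N) : TorVan A X N :=
  h.of_retract e.symm.toLinearMap e.toLinearMap (by simp)

/-- The decomposition of a sum of two disjoint submodules. -/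
def supEquivProd {P Q : Submodule A M} (h : Disjoint P Q) : ↥(P ⊔ Q) ≃ₗ[A] P × Q :=
  (LinearEquiv.ofBijective
    ((Submodule.inclusion le_sup_left).coprod (Submodule.inclusion le_sup_right))
    ⟨by
      rw [← LinearMap.ker_eq_bot, LinearMap.ker_coprod_of_disjoint_range]
      · simp [Submodule.ker_inclusion]
      · rw [Submodule.disjoint_def]
        rintro x ⟨y, rfl⟩ ⟨z, hz⟩
        have h1 : (z : M) = y := congrArg Subtype.val hz
        refine Subtype.ext ?_
        exact Submodule.disjoint_def.mp h _ y.2 (h1 ▸ z.2), by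
      rintro ⟨x, hx⟩
      obtain ⟨y, hy, z, hz, rfl⟩ := Submodule.mem_sup.mp hx
      exact ⟨(⟨y, hy⟩, ⟨z, hz⟩), rfl⟩⟩).symm

theorem supEquivProd_of_mem_right {P Q : Submodule A M} (h : Disjoint P Q) {x : M} (hx : x ∈ Q) :
    supEquivProd h ⟨x, Submodule.mem_sup_right hx⟩ = (0, ⟨x, hx⟩) := by
  rw [supEquivProd, LinearEquiv.symm_apply_eq]
  exact Subtype.ext (zero_add x).symm

theorem TorVan.sup {P Q : Submodule A M} (h : Disjoint P Q) (hP : TorVan A P N)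
    (hQ : TorVan A Q N) : TorVan A ↥(P ⊔ Q) N :=
  (hP.prod hQ).congr (supEquivProd h).symm

theorem TorVan.right_of_sup {P Q : Submodule A M} (h : Disjoint P Q)
    (hPQ : TorVan A ↥(P ⊔ Q) N) : TorVan A Q N :=
  (hPQ.congr (supEquivProd h)).of_retract (LinearMap.inr A P Q) (LinearMap.snd A P Q)
    (LinearMap.snd_comp_inr ..)

theorem TorVan.left_of_sup {P Q : Submodule A M} (h : Disjoint P Q)
    (hPQ : TorVan A ↥(P ⊔ Q) N) : TorVan A P N :=
  (hPQ.congr (supEquivProd h)).of_retract (LinearMap.inl A P Q) (LinearMap.fst A P Q)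
    (LinearMap.fst_comp_inl ..)

theorem mul_eq_zero_of_disjoint {I J : Ideal A} (h : Disjoint I J) {x y : A} (hx : x ∈ I)
    (hy : y ∈ J) : x * y = 0 :=
  Submodule.disjoint_def.mp h _ (I.mul_mem_right y hx) (J.mul_mem_left x hy)

section LocalDecomposition

variable [IsLocalRing A] {I J : Ideal A}

/-- For a module killed by `J`, the ideal `J` is a direct summand of the first syzygy. -/
theorem exists_cover_retract (hIJ : Disjoint I J) (hsup : I ⊔ J = maximalIdeal A)
    (X : Type) [AddCommGroup X] [Module A X] [Module.Finite A X] [Nontrivial X]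
    (hX : ∀ r ∈ J, ∀ x : X, r • x = 0) :
    ∃ (n : ℕ) (g : (Fin n → A) →ₗ[A] X), Function.Surjective g ∧
      (∀ x : LinearMap.ker g, ∀ j, (x : Fin n → A) j ∈ maximalIdeal A) ∧
      ∃ (s : J →ₗ[A] LinearMap.ker g) (p : LinearMap.ker g →ₗ[A] J),
        p ∘ₗ s = LinearMap.id := by
  obtain ⟨n, g, hg, hmin⟩ := exists_minimal_cover A X
  have hn : n ≠ 0 := by
    rintro rfl
    have := hg.subsingleton
    exact not_subsingleton X this
  let j₀ : Fin n := ⟨0, Nat.pos_of_ne_zero hn⟩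
  refine ⟨n, g, hg, fun x => hmin x x.2,
    ((LinearMap.single A (fun _ : Fin n => A) j₀) ∘ₗ J.subtype).codRestrict _ fun r => ?_,
    LinearMap.snd A I J ∘ₗ (supEquivProd hIJ).toLinearMap ∘ₗ
      ((LinearMap.proj j₀) ∘ₗ (LinearMap.ker g).subtype).codRestrict _
        fun x => hsup ▸ hmin x x.2 j₀, ?_⟩
  · have : Pi.single j₀ (r : A) = (r : A) • (Pi.single j₀ 1 : Fin n → A) := by
      rw [← Pi.single_smul, smul_eq_mul, mul_one]
    rw [LinearMap.mem_ker]
    change g (Pi.single j₀ (r : A)) = 0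
    rw [this, map_smul, hX _ r.2]
  · ext r
    have h : (Pi.single j₀ (r : A) : Fin n → A) j₀ = r := Pi.single_eq_same _ _
    have h' := supEquivProd_of_mem_right hIJ r.2
    simp only [LinearMap.comp_apply, LinearMap.id_apply]
    refine congrArg Subtype.val (?_ : _ = r)
    refine (congrArg Prod.snd (Eq.trans ?_ h'))
    exact congrArg (supEquivProd hIJ) (Subtype.ext h)

theorem TorVan.of_killed (hIJ : Disjoint I J) (hsup : I ⊔ J = maximalIdeal A)
    [Module.Finite A X] [Nontrivial X] (hX : ∀ r ∈ J, ∀ x : X, r • x = 0)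
    (h : TorVan A X N) : TorVan A J N := by
  obtain ⟨n, g, hg, -, s, p, hps⟩ := exists_cover_retract hIJ hsup X hX
  exact (h.syzygy (LinearMap.ker g).subtype g (Submodule.subtype_injective _) hg
    (LinearMap.exact_subtype_ker_map g)).of_retract s p hps

theorem TorZero.of_killed (hIJ : Disjoint I J) (hsup : I ⊔ J = maximalIdeal A)
    [Module.Finite A X] [Nontrivial X] (hX : ∀ r ∈ J, ∀ x : X, r • x = 0) {i : ℕ}
    (h : TorZero A X (A ⧸ maximalIdeal A) (i + 1)) : TorZero A J (A ⧸ maximalIdeal A) i := by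
  obtain ⟨n, g, hg, hmin, s, p, hps⟩ := exists_cover_retract hIJ hsup X hX
  refine TorZero.of_retract s p hps ?_
  have hex := LinearMap.exact_subtype_ker_map g
  cases i with
  | succ i =>
    exact (TorMod.shift (LinearMap.ker g).subtype g (Submodule.subtype_injective _) hg hex
      i).some.symm.toEquiv.subsingleton
  | zero =>
    obtain ⟨e⟩ := TorMod.one_equiv (N := A ⧸ maximalIdeal A) (LinearMap.ker g).subtype g
      (Submodule.subtype_injective _) hg hex
    obtain ⟨e₀⟩ := TorMod.zero_equiv (A := A) (M := LinearMap.ker g) (N := A ⧸ maximalIdeal A)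
    have h₁ := e.symm.toEquiv.subsingleton
    rw [Submodule.subsingleton_iff_eq_bot, rTensor_quotient_eq_zero _ _ hmin,
      LinearMap.ker_zero, ← Submodule.subsingleton_iff_eq_bot] at h₁
    exact (e₀.trans Submodule.topEquiv.symm).toEquiv.subsingleton

variable [IsNoetherianRing A]

theorem TorVan.residueField_of_killed (hIJ : Disjoint I J) (hsup : I ⊔ J = maximalIdeal A)
    (hJ : J ≠ ⊥) [Module.Finite A X] [Nontrivial X] (hX : ∀ r ∈ J, ∀ x : X, r • x = 0)
    (h : TorVan A X N) : TorVan A (A ⧸ maximalIdeal A) N := by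
  have := Submodule.nontrivial_iff_ne_bot.mpr hJ
  have h₁ := h.of_killed hIJ hsup hX
  have h₂ := h₁.of_killed hIJ.symm (sup_comm I J ▸ hsup)
    fun r hr x => Subtype.ext (mul_eq_zero_of_disjoint hIJ hr x.2)
  have h₃ := TorVan.sup hIJ h₂ h₁
  rw [hsup] at h₃
  exact h₃.of_syzygy (maximalIdeal A).subtype (maximalIdeal A).mkQ
    (Submodule.subtype_injective _) (Submodule.mkQ_surjective _)
    (LinearMap.exact_subtype_mkQ _)

theorem not_torVan_residueField (hIJ : Disjoint I J) (hsup : I ⊔ J = maximalIdeal A)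
    (hI : I ≠ ⊥) (hJ : J ≠ ⊥) :
    ¬ TorVan A (A ⧸ maximalIdeal A) (A ⧸ maximalIdeal A) := by
  intro h
  have := Submodule.nontrivial_iff_ne_bot.mpr hJ
  have hnI := Submodule.nontrivial_iff_ne_bot.mpr hI
  have h₁ := h.syzygy (maximalIdeal A).subtype (maximalIdeal A).mkQ
    (Submodule.subtype_injective _) (Submodule.mkQ_surjective _)
    (LinearMap.exact_subtype_mkQ _)
  have h₂ : TorVan A ↥(I ⊔ J) (A ⧸ maximalIdeal A) := by rwa [hsup]
  obtain ⟨n, hn⟩ := h₂.left_of_sup hIJ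
  obtain ⟨n', hn'⟩ := h₂.right_of_sup hIJ
  have key : ∀ i, TorZero A I (A ⧸ maximalIdeal A) i → TorZero A J (A ⧸ maximalIdeal A) i →
      False := by
    intro i
    induction i with
    | zero =>
      intro h0 _
      obtain ⟨e₀⟩ := TorMod.zero_equiv (A := A) (M := I) (N := A ⧸ maximalIdeal A)
      have : Subsingleton (ResidueField A ⊗[A] I) :=
        (TensorProduct.comm A I (A ⧸ maximalIdeal A) |>.symm.trans
          e₀.symm).toEquiv.subsingleton
      exact not_subsingleton I (IsLocalRing.subsingleton_tensorProduct.mp this)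
    | succ i ih =>
      intro h0 h0'
      exact ih
        (h0'.of_killed hIJ.symm (sup_comm I J ▸ hsup)
          fun r hr x => Subtype.ext (mul_eq_zero_of_disjoint hIJ hr x.2))
        (h0.of_killed hIJ hsup
          fun r hr x => Subtype.ext (mul_eq_zero_of_disjoint hIJ.symm hr x.2))
  exact key (max n n') (hn _ (le_max_left ..)) (hn' _ (le_max_right ..))

/-- Over a decomposable maximal ideal, a module either has a minimal free resolution of length
one, or its second syzygy has a summand killed by one of the two ideals. -/
theorem minimalResolution_or_torVan (hIJ : Disjoint I J) (hsup : I ⊔ J = maximalIdeal A)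
    (hI : I ≠ ⊥) (hJ : J ≠ ⊥) (M : Type) [AddCommGroup M] [Module A M] [Module.Finite A M] :
    (∃ a b, Nonempty (HasMinimalLengthOneResolution A M a b)) ∨
      ∀ (N : Type) [AddCommGroup N] [Module A N], TorVan A M N →
        TorVan A (A ⧸ maximalIdeal A) N := by
  obtain ⟨b, g₀, hg₀, hmin₀⟩ := exists_minimal_cover A M
  obtain ⟨a, g₁, hg₁, hmin₁⟩ := exists_minimal_cover A (LinearMap.ker g₀)
  let f : (Fin a → A) →ₗ[A] (Fin b → A) := (LinearMap.ker g₀).subtype ∘ₗ g₁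
  have hf : ∀ x j, f x j ∈ maximalIdeal A := fun x => hmin₀ _ (g₁ x).2
  by_cases hK : LinearMap.ker g₁ = ⊥
  · refine Or.inl ⟨a, b, ⟨⟨f, g₀, ?_, hg₀, ?_, hf⟩⟩⟩
    · exact (Submodule.subtype_injective _).comp (LinearMap.ker_eq_bot.mp hK)
    · rw [LinearMap.exact_iff, LinearMap.range_comp_of_range_eq_top _
        (LinearMap.range_eq_top.mpr hg₁), Submodule.range_subtype]
  refine Or.inr fun N _ _ hN => ?_
  let pI : Submodule A (Fin a → A) := Submodule.pi Set.univ fun _ => I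
  let pJ : Submodule A (Fin a → A) := Submodule.pi Set.univ fun _ => J
  have hfmem : ∀ (L : Ideal A) (x : Fin a → A), (∀ j, x j ∈ L) → ∀ k, f x k ∈ L := by
    intro L x hx k
    rw [LinearMap.pi_apply_eq_sum_univ f x, Finset.sum_apply]
    exact L.sum_mem fun j _ => L.mul_mem_right _ (hx j)
  have hdis : Disjoint (LinearMap.ker g₁ ⊓ pI) (LinearMap.ker g₁ ⊓ pJ) := by
    rw [Submodule.disjoint_def]
    intro x hx hx'
    ext j
    exact Submodule.disjoint_def.mp hIJ _ (hx.2 j trivial) (hx'.2 j trivial)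
  have hker : ∀ x, f x = 0 → x ∈ LinearMap.ker g₁ := fun x hx => Subtype.ext hx
  have hsum : LinearMap.ker g₁ ⊓ pI ⊔ LinearMap.ker g₁ ⊓ pJ = LinearMap.ker g₁ := by
    refine le_antisymm (sup_le inf_le_left inf_le_left) fun x hx => ?_
    have hx' : ∀ j, ∃ y ∈ I, ∃ z ∈ J, y + z = x j := fun j =>
      Submodule.mem_sup.mp (hsup ▸ hmin₁ x hx j)
    choose y hy z hz hyz using hx'
    have hyz' : y + z = x := funext hyz
    have hfx : f y + f z = 0 := by
      rw [← map_add, hyz']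
      exact congrArg Subtype.val hx
    have hfy : f y = 0 := by
      ext k
      refine Submodule.disjoint_def.mp hIJ _ (hfmem I y hy k) ?_
      have h : f y k = - f z k := eq_neg_of_add_eq_zero_left (congrFun hfx k)
      rw [h]
      exact J.neg_mem (hfmem J z hz k)
    have hfz : f z = 0 := by rwa [hfy, zero_add] at hfx
    exact Submodule.mem_sup.mpr ⟨y, ⟨hker y hfy, fun j _ => hy j⟩, z,
      ⟨hker z hfz, fun j _ => hz j⟩, hyz'⟩
  have h₁ := hN.syzygy (LinearMap.ker g₀).subtype g₀ (Submodule.subtype_injective _) hg₀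
    (LinearMap.exact_subtype_ker_map g₀)
  have h₂ := h₁.syzygy (LinearMap.ker g₁).subtype g₁ (Submodule.subtype_injective _) hg₁
    (LinearMap.exact_subtype_ker_map g₁)
  have h₃ : TorVan A ↥(LinearMap.ker g₁ ⊓ pI ⊔ LinearMap.ker g₁ ⊓ pJ) N := by rwa [hsum]
  by_cases hX : LinearMap.ker g₁ ⊓ pI = ⊥
  · have hY : LinearMap.ker g₁ ⊓ pJ ≠ ⊥ := by
      intro hY
      rw [hX, hY, sup_bot_eq] at hsum
      exact hK hsum.symm
    have := Submodule.nontrivial_iff_ne_bot.mpr hY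
    exact (h₃.right_of_sup hdis).residueField_of_killed hIJ.symm (sup_comm I J ▸ hsup) hI
      fun r hr x => Subtype.ext <| funext fun j =>
        mul_eq_zero_of_disjoint hIJ hr (x.2.2 j trivial)
  · have := Submodule.nontrivial_iff_ne_bot.mpr hX
    exact (h₃.left_of_sup hdis).residueField_of_killed hIJ hsup hJ
      fun r hr x => Subtype.ext <| funext fun j =>
        mul_eq_zero_of_disjoint hIJ.symm hr (x.2.2 j trivial)

theorem exists_minimalResolution_of_torVan (hIJ : Disjoint I J) (hsup : I ⊔ J = maximalIdeal A)
    (hI : I ≠ ⊥) (hJ : J ≠ ⊥) [Module.Finite A M] [Module.Finite A N] (h : TorVan A M N) :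
    (∃ a b, Nonempty (HasMinimalLengthOneResolution A M a b)) ∨
      ∃ a b, Nonempty (HasMinimalLengthOneResolution A N a b) := by
  refine (minimalResolution_or_torVan hIJ hsup hI hJ M).imp_right fun hM => ?_
  refine (minimalResolution_or_torVan hIJ hsup hI hJ N).resolve_right fun hN => ?_
  exact not_torVan_residueField hIJ hsup hI hJ (hN _ (hM _ h).symm)

end LocalDecomposition

theorem DExtZero.exists_lift (f : K →ₗ[A] F) (g : F →ₗ[A] M) (hf : Function.Injective f)
    (hg : Function.Surjective g) (hfg : Function.Exact f g) (h : DExtZero A X K 1)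
    (φ : X →ₗ[A] M) : ∃ ψ : X →ₗ[A] F, g ∘ₗ ψ = φ := by
  obtain ⟨S, hS, rfl⟩ := shortExact_of_linear f g hf hg hfg
  obtain ⟨y, hy⟩ := Abelian.Ext.covariant_sequence_exact₃ (ModuleCat.of A X) hS
    (Abelian.Ext.mk₀ (ModuleCat.ofHom φ)) rfl (h.elim _ _)
  obtain ⟨ψ, rfl⟩ := (Abelian.Ext.mk₀_bijective _ _).2 y
  rw [Abelian.Ext.mk₀_comp_mk₀] at hy
  have := (Abelian.Ext.mk₀_bijective _ _).1 hy
  exact ⟨ψ.hom, congrArg ModuleCat.Hom.hom this⟩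

theorem IsFirstSyzygy.torZero_one (h : IsFirstSyzygy A N)
    (hM : ∀ (L : Type) [AddCommGroup L] [Module A L], TorZero A M L 2) : TorZero A M N 1 := by
  obtain ⟨n, f, hf⟩ := h
  have h₂ : TorZero A ((Fin n → A) ⧸ LinearMap.range f) M 2 := (hM _).symm
  exact TorZero.symm (TorMod.shift f (LinearMap.range f).mkQ hf (Submodule.mkQ_surjective _)
    (LinearMap.exact_map_mkQ_range f) 0).some.symm.toEquiv.subsingleton

theorem IsFirstSyzygy.congr (e : M ≃ₗ[A] N) (h : IsFirstSyzygy A N) : IsFirstSyzygy A M := by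
  obtain ⟨n, f, hf⟩ := h
  exact ⟨n, f ∘ₗ e.toLinearMap, hf.comp e.injective⟩

section LocalDecomposition

variable [IsLocalRing A] {I J : Ideal A}

theorem eq_bot_of_smul_eq_zero (hIJ : Disjoint I J) (hsup : I ⊔ J = maximalIdeal A)
    {x : A ⧸ I} (hx : ∀ r ∈ maximalIdeal A, r • x = 0) {a : A} (ha : Submodule.Quotient.mk a = x)
    (hau : a ∉ maximalIdeal A) : J = ⊥ := by
  rw [eq_bot_iff]
  intro r hr
  have hu : IsUnit a := by simpa using hau
  have h := hx r (hsup ▸ Submodule.mem_sup_right hr)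
  rw [← ha, ← Submodule.Quotient.mk_smul, Submodule.Quotient.mk_eq_zero, smul_eq_mul,
    mul_comm, I.unit_mul_mem_iff_mem hu] at h
  exact Submodule.disjoint_def.mp hIJ _ h hr

theorem not_dExtZero_residueField_one (hIJ : Disjoint I J) (hsup : I ⊔ J = maximalIdeal A)
    (hI : I ≠ ⊥) (hJ : J ≠ ⊥) : ¬ DExtZero A (A ⧸ maximalIdeal A) A 1 := by
  intro h
  have hIm : I ≤ maximalIdeal A := hsup ▸ le_sup_left
  have hJm : J ≤ maximalIdeal A := hsup ▸ le_sup_right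
  obtain ⟨ψ, hψ⟩ := h.exists_lift (I.mkQ.prod J.mkQ)
    ((Submodule.factor hIm) ∘ₗ LinearMap.fst A (A ⧸ I) (A ⧸ J) -
      (Submodule.factor hJm) ∘ₗ LinearMap.snd A (A ⧸ I) (A ⧸ J))
    (by
      rw [← LinearMap.ker_eq_bot, LinearMap.ker_prod, Submodule.ker_mkQ, Submodule.ker_mkQ,
        disjoint_iff.mp hIJ])
    (by
      intro z
      obtain ⟨a, rfl⟩ := Submodule.mkQ_surjective _ z
      exact ⟨(I.mkQ a, 0), by simp⟩)
    (by
      rintro ⟨x, y⟩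
      obtain ⟨a, rfl⟩ := Submodule.mkQ_surjective _ x
      obtain ⟨b, rfl⟩ := Submodule.mkQ_surjective _ y
      constructor
      · intro hab
        have hab' : (maximalIdeal A).mkQ a - (maximalIdeal A).mkQ b = 0 := hab
        rw [← map_sub, Submodule.mkQ_apply, Submodule.Quotient.mk_eq_zero, ← hsup] at hab'
        obtain ⟨i, hi, j, hj, hij⟩ := Submodule.mem_sup.mp hab'
        refine ⟨a - i, Prod.ext ?_ ?_⟩
        · refine (Submodule.Quotient.eq I).mpr ?_
          simpa using hi
        · refine (Submodule.Quotient.eq J).mpr ?_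
          have : a - i - b = j := by linear_combination -hij
          rwa [this]
      · rintro ⟨c, hc⟩
        rw [← hc]
        exact sub_self ((maximalIdeal A).mkQ c))
    LinearMap.id
  have hm : ∀ r ∈ maximalIdeal A, r • ψ (Submodule.Quotient.mk 1) = 0 := by
    intro r hr
    rw [← map_smul, ← Submodule.Quotient.mk_smul, smul_eq_mul, mul_one,
      (Submodule.Quotient.mk_eq_zero _).mpr hr, map_zero]
  obtain ⟨a, ha⟩ := Submodule.mkQ_surjective _ (ψ (Submodule.Quotient.mk 1)).1
  obtain ⟨b, hb⟩ := Submodule.mkQ_surjective _ (ψ (Submodule.Quotient.mk 1)).2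
  have ham : a ∈ maximalIdeal A := by
    by_contra hau
    exact hJ (eq_bot_of_smul_eq_zero hIJ hsup (fun r hr => congrArg Prod.fst (hm r hr)) ha hau)
  have hbm : b ∈ maximalIdeal A := by
    by_contra hbu
    exact hI (eq_bot_of_smul_eq_zero hIJ.symm (sup_comm I J ▸ hsup)
      (fun r hr => congrArg Prod.snd (hm r hr)) hb hbu)
  have h₁ := LinearMap.congr_fun hψ (Submodule.Quotient.mk 1)
  rw [LinearMap.comp_apply, LinearMap.sub_apply, LinearMap.comp_apply, LinearMap.comp_apply,
    LinearMap.fst_apply, LinearMap.snd_apply, ← ha, ← hb] at h₁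
  have h₂ : (Submodule.Quotient.mk (p := maximalIdeal A) a) - Submodule.Quotient.mk b =
    Submodule.Quotient.mk 1 := h₁
  rw [(Submodule.Quotient.mk_eq_zero _).mpr ham, (Submodule.Quotient.mk_eq_zero _).mpr hbm,
    sub_zero, eq_comm, Submodule.Quotient.mk_eq_zero] at h₂
  exact (Ideal.ne_top_iff_one _).mp (maximalIdeal.isMaximal A).ne_top h₂

theorem IsFirstSyzygy.dExtZero (h : IsFirstSyzygy A M)
    (hA : DExtZero A (A ⧸ maximalIdeal A) A 0) : DExtZero A (A ⧸ maximalIdeal A) M 0 := by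
  obtain ⟨n, f, hf⟩ := h
  exact (hA.pi n).zero_of_injective f hf

theorem TorMod.zero_depthM_eq_of_equiv {n : ℕ} (hn : n ≠ 0) (e : (Fin n → A) ≃ₗ[A] M) :
    depthM A (TorMod A M N 0) = depthM A N := by
  obtain ⟨e₀⟩ := TorMod.zero_equiv (A := A) (M := M) (N := N)
  rw [depthM_congr_equiv (e₀.trans (TensorProduct.congr e.symm (LinearEquiv.refl A N)))]
  exact depthM_congr fun i => dExtZero_pi_tensor_iff hn

theorem depthM_eq_of_equiv {n : ℕ} (hn : n ≠ 0) (e : (Fin n → A) ≃ₗ[A] M) :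
    depthM A M = depthM A A := by
  rw [← depthM_congr_equiv e]
  exact depthM_congr fun i => DExtZero.pi_iff hn

namespace HasMinimalLengthOneResolution

variable {a b : ℕ}

theorem exists_equiv (P : HasMinimalLengthOneResolution A M 0 b) :
    Nonempty ((Fin b → A) ≃ₗ[A] M) := by
  refine ⟨LinearEquiv.ofBijective P.g ⟨?_, P.surjective⟩⟩
  rw [← LinearMap.ker_eq_bot, P.exact.linearMap_ker_eq, LinearMap.range_eq_bot]
  exact Subsingleton.elim _ _

/-- The depth formula for a module with a minimal free resolution of length at most one. -/
theorem depth_formula (P : HasMinimalLengthOneResolution A M a b) [Nontrivial M]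
    (hA : ¬ DExtZero A (A ⧸ maximalIdeal A) A 1) {q : ℕ} (hq : ∀ i > q, TorZero A M N i)
    (hq' : q ≠ 0 → ¬ TorZero A M N q)
    (hC : q = 0 ∨ depthM A (TorMod A M N q) ≤ 1 ∨ ¬ DExtZero A (A ⧸ maximalIdeal A) A 0 ∨
      IsFirstSyzygy A M ∨ IsFirstSyzygy A N ∨ depthM A N = 0) :
    q ≤ 1 ∧ depthM A M + depthM A N = depthM A A + depthM A (TorMod A M N q) - (q : ℕ∞) := by
  by_cases ha : a = 0
  · subst ha
    obtain ⟨e⟩ := P.exists_equiv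
    have hb : b ≠ 0 := by
      rintro rfl
      exact not_subsingleton M e.symm.toEquiv.subsingleton
    have : Module.Flat A M := Module.Flat.of_linearEquiv e.symm
    obtain rfl : q = 0 := by
      by_contra h0
      obtain ⟨r, rfl⟩ := Nat.exists_eq_succ_of_ne_zero h0
      exact hq' h0 (TorZero.of_flat r)
    rw [TorMod.zero_depthM_eq_of_equiv hb e, depthM_eq_of_equiv hb e]
    simp
  have hA0 := P.dExtZero_ring_zero ha
  have hq1 : q ≤ 1 := by
    by_contra h
    obtain ⟨r, rfl⟩ : ∃ r, q = r + 2 := ⟨q - 2, by omega⟩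
    exact hq' (by omega) (P.torZero r)
  refine ⟨hq1, ?_⟩
  rw [P.depthM_eq_zero ha hA, depthM_eq_one_iff.mpr ⟨hA0, hA⟩, zero_add]
  by_cases hN : DExtZero A (A ⧸ maximalIdeal A) N 0
  · interval_cases q
    · rw [P.depthM_eq_depthM_tor_zero_add_one ha hN (hq 1 one_pos), add_comm]
      simp
    · have hd : depthM A (TorMod A M N 1) ≤ 1 := by
        rcases hC with h | h | h | h | h | h
        · exact absurd h one_ne_zero
        · exact h
        · exact absurd hA0 h
        · exact absurd (h.dExtZero hA0) (depthM_eq_zero_iff.mp (P.depthM_eq_zero ha hA))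
        · exact absurd (h.torZero_one fun L _ _ => P.torZero 0) (hq' one_ne_zero)
        · exact absurd hN (depthM_eq_zero_iff.mp h)
      obtain ⟨h₁, h₂⟩ := P.depthM_eq_one_of_depthM_tor_one_le ha hN hd
      rw [h₁, h₂]
      rfl
  · have hT := P.not_dExtZero_tor_one ha hN
    obtain rfl : q = 1 := by
      refine le_antisymm hq1 (Nat.one_le_iff_ne_zero.mpr fun h => hT ?_)
      have : TorZero A M N 1 := hq 1 (by omega)
      rw [dExtZero_zero_iff]
      exact fun x _ => Subsingleton.elim _ _
    rw [depthM_eq_zero_iff.mpr hN, depthM_eq_zero_iff.mpr hT]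
    rfl

end HasMinimalLengthOneResolution

variable [IsNoetherianRing A]

theorem isFirstSyzygy_quotient (hIJ : Disjoint I J) (hsup : I ⊔ J = maximalIdeal A)
    (hI : I ≠ ⊥) (hA : DExtZero A (A ⧸ maximalIdeal A) A 0) : IsFirstSyzygy A (A ⧸ J) := by
  obtain ⟨n, x, hx⟩ := Submodule.fg_iff_exists_fin_generating_family.mp (IsNoetherian.noetherian I)
  have hxI : ∀ j, x j ∈ I := fun j => hx ▸ Submodule.subset_span ⟨j, rfl⟩
  let f : A →ₗ[A] (Fin n → A) := LinearMap.toSpanSingleton A _ x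
  have hf : LinearMap.ker f = J := by
    ext a
    rw [LinearMap.mem_ker, LinearMap.toSpanSingleton_apply]
    refine ⟨fun ha => ?_, fun ha => funext fun j => mul_eq_zero_of_disjoint hIJ.symm ha (hxI j)⟩
    have haI : ∀ i ∈ I, a * i = 0 := by
      intro i hi
      have h : I ≤ LinearMap.ker (LinearMap.mulLeft A a) := by
        rw [← hx, Submodule.span_le]
        rintro _ ⟨j, rfl⟩
        exact congrFun ha j
      exact h hi
    have ham : a ∈ maximalIdeal A := by
      by_contra hau
      have hu : IsUnit a := by simpa using hau
      exact hI ((Submodule.eq_bot_iff I).mpr fun i hi => hu.mul_right_eq_zero.mp (haI i hi))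
    obtain ⟨i, hi, j, hj, rfl⟩ := Submodule.mem_sup.mp (hsup ▸ ham)
    have h0 : i = 0 := by
      refine (dExtZero_zero_iff _).mp hA i fun r hr => ?_
      obtain ⟨i', hi', j', hj', rfl⟩ := Submodule.mem_sup.mp (hsup ▸ hr)
      have h₁ := haI i' hi'
      have h₂ := mul_eq_zero_of_disjoint hIJ hi' hj
      have h₃ := mul_eq_zero_of_disjoint hIJ hi hj'
      rw [smul_eq_mul]
      linear_combination h₁ - h₂ + h₃
    rwa [h0, zero_add]
  exact ⟨n, J.liftQ f hf.ge, LinearMap.ker_eq_bot.mp (Submodule.ker_liftQ_eq_bot _ _ _ hf.le)⟩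

/-- The depth formula over a local ring with decomposable maximal ideal. -/
theorem depth_formula_of_disjoint (hIJ : Disjoint I J) (hsup : I ⊔ J = maximalIdeal A)
    (hI : I ≠ ⊥) (hJ : J ≠ ⊥) [Module.Finite A M] [Module.Finite A N] [Nontrivial M]
    [Nontrivial N] {q : ℕ} (hq : ∀ i > q, TorZero A M N i) (hq' : q ≠ 0 → ¬ TorZero A M N q)
    (hC : q = 0 ∨ depthM A (TorMod A M N q) ≤ 1 ∨ ¬ DExtZero A (A ⧸ maximalIdeal A) A 0 ∨
      (IsFirstSyzygy A M ∨ IsFirstSyzygy A N) ∨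
      depthM A N = 0 ∧ ¬ ∃ n : ℕ, PdLE A N n) :
    q ≤ 1 ∧ depthM A M + depthM A N = depthM A A + depthM A (TorMod A M N q) - (q : ℕ∞) := by
  have hA := not_dExtZero_residueField_one hIJ hsup hI hJ
  rcases exists_minimalResolution_of_torVan hIJ hsup hI hJ
    (⟨q + 1, fun i hi => hq i hi⟩ : TorVan A M N) with ⟨a, b, ⟨P⟩⟩ | ⟨a, b, ⟨P⟩⟩
  · exact P.depth_formula hA hq hq' (by tauto)
  · obtain ⟨e⟩ := TorMod.symm_equiv (A := A) M N q
    rw [add_comm (depthM A M), depthM_congr_equiv e]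
    rw [depthM_congr_equiv e] at hC
    have hpd : ∃ n, PdLE A N n := ⟨1, P.pdLE⟩
    exact P.depth_formula hA (fun i hi => (hq i hi).symm) (fun h h' => hq' h h'.symm) (by tauto)

end LocalDecomposition

theorem isNoetherian_of_algebraMap_surjective (A B : Type) [CommRing A] [CommRing B]
    [Algebra A B] [IsNoetherianRing B] (h : Function.Surjective (algebraMap A B)) :
    IsNoetherian A B := by
  rw [isNoetherian_iff']
  have : WellFoundedGT (Submodule B B) := isNoetherian_iff'.mp ‹_›
  exact (Submodule.orderIsoOfAlgebraMapSurjective (M := B) h).symm.toOrderEmbedding.wellFoundedGT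

theorem isNoetherianRing_of_disjoint_ker {A B C : Type} [CommRing A] [CommRing B] [CommRing C]
    [IsNoetherianRing B] [IsNoetherianRing C] (f : A →+* B) (g : A →+* C)
    (hf : Function.Surjective f) (hg : Function.Surjective g)
    (h : Disjoint (RingHom.ker f) (RingHom.ker g)) : IsNoetherianRing A := by
  algebraize [f, g]
  have : IsNoetherian A B := isNoetherian_of_algebraMap_surjective A B hf
  have : IsNoetherian A C := isNoetherian_of_algebraMap_surjective A C hg
  refine isNoetherian_of_injective ((Algebra.linearMap A B).prod (Algebra.linearMap A C)) ?_
  rw [← LinearMap.ker_eq_bot, LinearMap.ker_prod]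
  exact disjoint_iff.mp h

theorem maximalIdeal_eq_comap {A B : Type} [CommRing A] [CommRing B] [IsLocalRing A]
    [IsLocalRing B] (f : A →+* B) (hf : Function.Surjective f) :
    (maximalIdeal B).comap f = maximalIdeal A :=
  IsLocalRing.eq_maximalIdeal (Ideal.comap_isMaximal_of_surjective f hf)

theorem isFirstSyzygy_compHom {A B : Type} [CommRing A] [CommRing B] (f : A →+* B)
    (hf : Function.Surjective f) (h : IsFirstSyzygy A (A ⧸ RingHom.ker f)) :
    letI : Module A B := Module.compHom B f
    IsFirstSyzygy A B := by
  let : Module A B := Module.compHom B f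
  let f' : A →ₗ[A] B :=
    { toFun := f
      map_add' := map_add f
      map_smul' := map_mul f }
  have hk : LinearMap.ker f' = RingHom.ker f := rfl
  rw [← hk] at h
  exact h.congr (f'.quotKerEquivOfSurjective hf).symm

theorem exists_socle_of_depthM_eq_zero {A : Type} [CommRing A] [IsLocalRing A]
    (hm : maximalIdeal A ≠ ⊥) (h : depthM A A = 0) :
    ∃ x ∈ maximalIdeal A, x ≠ 0 ∧ ∀ r ∈ maximalIdeal A, r * x = 0 := by
  rw [depthM_eq_zero_iff, dExtZero_zero_iff] at h
  push Not at h
  obtain ⟨x, hx, hx0⟩ := h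
  refine ⟨x, ?_, hx0, hx⟩
  by_contra hxu
  have hu : IsUnit x := by simpa using hxu
  exact hm ((Submodule.eq_bot_iff _).mpr fun r hr => hu.mul_left_eq_zero.mp (hx r hr))

theorem not_dExtZero_of_depthM_eq_zero {A B : Type} [CommRing A] [CommRing B] [IsLocalRing A]
    [IsLocalRing B] (f : A →+* B) (hf : Function.Surjective f) {I : Ideal A}
    (hI : Disjoint I (RingHom.ker f)) (hlift : ∀ b ∈ maximalIdeal B, ∃ x ∈ I, f x = b)
    (hm : maximalIdeal B ≠ ⊥) (h : depthM B B = 0) :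
    ¬ DExtZero A (A ⧸ maximalIdeal A) A 0 := by
  obtain ⟨b, hb, hb0, hmb⟩ := exists_socle_of_depthM_eq_zero hm h
  obtain ⟨x, hx, rfl⟩ := hlift b hb
  rw [dExtZero_zero_iff]
  intro h'
  have hx0 : x = 0 := by
    refine h' x fun r hr => Submodule.disjoint_def.mp hI _ (I.mul_mem_left r hx) ?_
    rw [← maximalIdeal_eq_comap f hf] at hr
    rw [RingHom.mem_ker, smul_eq_mul, map_mul, hmb _ hr]
  exact hb0 (by rw [hx0, map_zero])

section FiberProduct

variable {S T k : Type} [CommRing S] [CommRing T] [Field k] {πS : S →+* k} {πT : T →+* k}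

theorem ρS_surjective (hπT : Function.Surjective πT) : Function.Surjective (ρS πS πT) := by
  intro s
  obtain ⟨t, ht⟩ := hπT (πS s)
  exact ⟨⟨(s, t), ht.symm⟩, rfl⟩

theorem ρT_surjective (hπS : Function.Surjective πS) : Function.Surjective (ρT πS πT) := by
  intro t
  obtain ⟨s, hs⟩ := hπS (πT t)
  exact ⟨⟨(s, t), hs⟩, rfl⟩

theorem fiberProd_ext {x y : ↥(fiberProd πS πT)} (hS : ρS πS πT x = ρS πS πT y)
    (hT : ρT πS πT x = ρT πS πT y) : x = y :=
  Subtype.ext (Prod.ext hS hT)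

theorem disjoint_ker_ρ : Disjoint (RingHom.ker (ρT πS πT)) (RingHom.ker (ρS πS πT)) := by
  rw [Submodule.disjoint_def]
  intro x hx hx'
  exact fiberProd_ext (hx'.trans (map_zero _).symm) (hx.trans (map_zero _).symm)

theorem exists_left {s : S} (hs : πS s = 0) :
    ∃ x : ↥(fiberProd πS πT), ρS πS πT x = s ∧ ρT πS πT x = 0 :=
  ⟨⟨(s, 0), hs.trans (map_zero πT).symm⟩, rfl, rfl⟩

theorem exists_right {t : T} (ht : πT t = 0) :
    ∃ x : ↥(fiberProd πS πT), ρS πS πT x = 0 ∧ ρT πS πT x = t :=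
  ⟨⟨(0, t), (map_zero πS).trans ht.symm⟩, rfl, rfl⟩

theorem ker_ρT_ne_bot [IsLocalRing S] (hkS : RingHom.ker πS = maximalIdeal S)
    (hS : maximalIdeal S ≠ ⊥) : RingHom.ker (ρT πS πT) ≠ ⊥ := by
  obtain ⟨s, hs, hs0⟩ := Submodule.exists_mem_ne_zero_of_ne_bot hS
  rw [← hkS] at hs
  obtain ⟨x, rfl, hx⟩ := exists_left (πT := πT) hs
  refine (Submodule.ne_bot_iff _).mpr ⟨x, hx, ?_⟩
  rintro rfl
  exact hs0 (map_zero _)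

theorem ker_ρS_ne_bot [IsLocalRing T] (hkT : RingHom.ker πT = maximalIdeal T)
    (hT : maximalIdeal T ≠ ⊥) : RingHom.ker (ρS πS πT) ≠ ⊥ := by
  obtain ⟨t, ht, ht0⟩ := Submodule.exists_mem_ne_zero_of_ne_bot hT
  rw [← hkT] at ht
  obtain ⟨x, hx, rfl⟩ := exists_right (πS := πS) ht
  refine (Submodule.ne_bot_iff _).mpr ⟨x, hx, ?_⟩
  rintro rfl
  exact ht0 (map_zero _)

variable [IsLocalRing ↥(fiberProd πS πT)]

theorem ker_ρ_sup [IsLocalRing S] [IsLocalRing T] (hπS : Function.Surjective πS)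
    (hπT : Function.Surjective πT) (hkS : RingHom.ker πS = maximalIdeal S)
    (hkT : RingHom.ker πT = maximalIdeal T) :
    RingHom.ker (ρT πS πT) ⊔ RingHom.ker (ρS πS πT) = maximalIdeal ↥(fiberProd πS πT) := by
  have hcS := maximalIdeal_eq_comap (ρS πS πT) (ρS_surjective (πS := πS) hπT)
  have hcT := maximalIdeal_eq_comap (ρT πS πT) (ρT_surjective (πT := πT) hπS)
  refine le_antisymm (sup_le ?_ ?_) fun x hx => ?_
  · rw [← hcT]
    exact Ideal.ker_le_comap _
  · rw [← hcS]
    exact Ideal.ker_le_comap _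
  · have h₁ : πS (ρS πS πT x) = 0 := by
      rwa [← hcS, Ideal.mem_comap, ← hkS] at hx
    have h₂ : πT (ρT πS πT x) = 0 := by
      rwa [← hcT, Ideal.mem_comap, ← hkT] at hx
    obtain ⟨y, hy, hy'⟩ := exists_left (πT := πT) h₁
    obtain ⟨z, hz, hz'⟩ := exists_right (πS := πS) h₂
    refine Submodule.mem_sup.mpr ⟨y, hy', z, hz, fiberProd_ext ?_ ?_⟩
    · rw [map_add, hy, hz, add_zero]
    · rw [map_add, hy', hz', zero_add]

end FiberProduct

end DepthFormula

/-- Theorem 3.1: the depth formula over the fiber product `R = S ×ₖ T`, under any of the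
six conditions (1)–(6). -/
theorem stmt_11 (S T k : Type) [CommRing S] [CommRing T] [Field k]
    [IsNoetherianRing S] [IsNoetherianRing T] [IsLocalRing S] [IsLocalRing T]
    (πS : S →+* k) (πT : T →+* k)
    (hπS : Function.Surjective πS) (hπT : Function.Surjective πT)
    (hkS : RingHom.ker πS = maximalIdeal S) (hkT : RingHom.ker πT = maximalIdeal T)
    (hS : maximalIdeal S ≠ ⊥) (hT : maximalIdeal T ≠ ⊥)
    [IsLocalRing ↥(fiberProd πS πT)]
    (M N : Type) [AddCommGroup M] [Module ↥(fiberProd πS πT) M]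
    [Module.Finite ↥(fiberProd πS πT) M] [Nontrivial M]
    [AddCommGroup N] [Module ↥(fiberProd πS πT) N]
    [Module.Finite ↥(fiberProd πS πT) N] [Nontrivial N]
    (hvan : ∃ n : ℕ, ∀ i ≥ n, TorZero ↥(fiberProd πS πT) M N i) :
    letI : Module ↥(fiberProd πS πT) S := Module.compHom S (ρS πS πT)
    letI : Module ↥(fiberProd πS πT) T := Module.compHom T (ρT πS πT)
    ∀ q : ℕ, q = sSup {i : ℕ | ¬ TorZero ↥(fiberProd πS πT) M N i} →
    ((q = 0) ∨
     (depthM ↥(fiberProd πS πT)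
        (((Tor (ModuleCat ↥(fiberProd πS πT)) q).obj
          (ModuleCat.of ↥(fiberProd πS πT) M)).obj (ModuleCat.of ↥(fiberProd πS πT) N)) ≤ 1) ∨
     (depthM S S = 0 ∨ depthM T T = 0) ∨
     (IsFirstSyzygy ↥(fiberProd πS πT) M ∨ IsFirstSyzygy ↥(fiberProd πS πT) N) ∨
     (Nonempty (M ≃ₗ[↥(fiberProd πS πT)] S) ∨ Nonempty (M ≃ₗ[↥(fiberProd πS πT)] T) ∨
      Nonempty (N ≃ₗ[↥(fiberProd πS πT)] S) ∨ Nonempty (N ≃ₗ[↥(fiberProd πS πT)] T)) ∨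
     (depthM ↥(fiberProd πS πT) N = 0 ∧ ¬ ∃ n : ℕ, PdLE ↥(fiberProd πS πT) N n)) →
    (q ≤ 1 ∧
      depthM ↥(fiberProd πS πT) M + depthM ↥(fiberProd πS πT) N =
        depthM ↥(fiberProd πS πT) ↥(fiberProd πS πT) +
          depthM ↥(fiberProd πS πT)
            (((Tor (ModuleCat ↥(fiberProd πS πT)) q).obj
              (ModuleCat.of ↥(fiberProd πS πT) M)).obj (ModuleCat.of ↥(fiberProd πS πT) N)) -
          (q : ℕ∞)) := by
  let : Module ↥(fiberProd πS πT) S := Module.compHom S (ρS πS πT)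
  let : Module ↥(fiberProd πS πT) T := Module.compHom T (ρT πS πT)
  intro q hqdef hC
  have hdis := disjoint_ker_ρ (πS := πS) (πT := πT)
  have hsup := ker_ρ_sup hπS hπT hkS hkT
  have hI := ker_ρT_ne_bot (πT := πT) hkS hS
  have hJ := ker_ρS_ne_bot (πS := πS) hkT hT
  have : IsNoetherianRing ↥(fiberProd πS πT) :=
    isNoetherianRing_of_disjoint_ker _ _ (ρT_surjective hπS) (ρS_surjective hπT) hdis
  obtain ⟨n, hn⟩ := hvan
  have hbdd : BddAbove {i : ℕ | ¬ TorZero ↥(fiberProd πS πT) M N i} :=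
    ⟨n, fun i hi => le_of_not_ge fun h => hi (hn i h)⟩
  refine depth_formula_of_disjoint hdis hsup hI hJ (fun i hi => ?_) (fun h0 => ?_) ?_
  · by_contra h
    exact absurd (le_csSup hbdd h) (not_le.mpr (hqdef ▸ hi))
  · rw [hqdef]
    refine Nat.sSup_mem (Set.nonempty_iff_ne_empty.mpr fun h => h0 ?_) hbdd
    rw [hqdef, h, csSup_empty, bot_eq_zero]
  by_cases hA : DExtZero ↥(fiberProd πS πT)
      (↥(fiberProd πS πT) ⧸ maximalIdeal ↥(fiberProd πS πT)) ↥(fiberProd πS πT) 0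
  · have hFS : IsFirstSyzygy ↥(fiberProd πS πT) S :=
      isFirstSyzygy_compHom _ (ρS_surjective hπT) (isFirstSyzygy_quotient hdis hsup hI hA)
    have hFT : IsFirstSyzygy ↥(fiberProd πS πT) T :=
      isFirstSyzygy_compHom _ (ρT_surjective hπS)
        (isFirstSyzygy_quotient hdis.symm (sup_comm (RingHom.ker (ρT πS πT)) _ ▸ hsup) hJ hA)
    rcases hC with h | h | h | h | h | h
    · exact Or.inl h
    · exact Or.inr (Or.inl h)
    · rcases h with h | h
      · refine absurd hA (not_dExtZero_of_depthM_eq_zero _ (ρS_surjective hπT) hdis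
          (fun s hs => ?_) hS h)
        obtain ⟨x, hx, hx'⟩ := exists_left (πT := πT) (s := s) (hkS.ge hs)
        exact ⟨x, hx', hx⟩
      · refine absurd hA (not_dExtZero_of_depthM_eq_zero _ (ρT_surjective hπS) hdis.symm
          (fun t ht => ?_) hT h)
        exact exists_right (πS := πS) (t := t) (hkT.ge ht)
    · exact Or.inr (Or.inr (Or.inr (Or.inl h)))
    · refine Or.inr (Or.inr (Or.inr (Or.inl ?_)))
      rcases h with ⟨⟨e⟩⟩ | ⟨⟨e⟩⟩ | ⟨⟨e⟩⟩ | ⟨⟨e⟩⟩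
      · exact Or.inl (hFS.congr e)
      · exact Or.inl (hFT.congr e)
      · exact Or.inr (hFS.congr e)
      · exact Or.inr (hFT.congr e)
    · exact Or.inr (Or.inr (Or.inr (Or.inr h)))
  · exact Or.inr (Or.inr (Or.inl hA))
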